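/- Under the standard assumptions, let J = G[C ∪ {a,b}]. For every edge e of J: (1) J − e − a is planar or J − e − b is planar (or both); and (2) J/e − a is planar or J/e − b is planar (or both), where if e is incident to a (resp. b) in J then the vertex resulting from contracting e in J/e is labeled a (resp. b). -/

import Mathlib

open SimpleGraph

/-- The complete graph on five vertices. -/
def K5 : SimpleGraph (Fin 5) := ⊤

/-- The complete bipartite graph `K_{3,3}`. -/
def K33 : SimpleGraph (Fin 6) :=
  SimpleGraph.fromRel (fun i j => i.val < 3 ∧ 3 ≤ j.val)

/-- `K_{3,3}` plus one extra edge joining two vertices in the same part. -/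
def K33e : SimpleGraph (Fin 6) :=
  SimpleGraph.fromRel (fun i j => (i.val < 3 ∧ 3 ≤ j.val) ∨ (i.val = 0 ∧ j.val = 1))

/-- `H` is a minor of `G`, witnessed by a family of nonempty, connected,
pairwise disjoint branch sets together with edges between the branch sets of
adjacent vertices of `H`. -/
def SimpleGraph.IsMinorOf {W V : Type} (H : SimpleGraph W) (G : SimpleGraph V) : Prop :=
  ∃ f : W → Set V,
    (∀ w, (G.induce (f w)).Connected) ∧
    (Pairwise fun w w' => Disjoint (f w) (f w')) ∧
    (∀ ⦃w w'⦄, H.Adj w w' → ∃ u ∈ f w, ∃ v ∈ f w', G.Adj u v)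

/-- Planarity, via the Kuratowski–Wagner characterization: a (finite simple) graph is
planar iff it has no `K₅` minor and no `K_{3,3}` minor. -/
def IsPlanar {V : Type} (G : SimpleGraph V) : Prop :=
  ¬ K5.IsMinorOf G ∧ ¬ K33.IsMinorOf G

/-- A graph is apex if it is planar or some vertex deletion makes it planar. -/
def IsApex {V : Type} (G : SimpleGraph V) : Prop :=
  IsPlanar G ∨ ∃ v : V, IsPlanar (G.induce {u | u ≠ v})

/-- `G` is an obstruction for the apex family: it is not apex, but every minor of it
that is not isomorphic to it is apex. -/
def IsApexObstruction {V : Type} (G : SimpleGraph V) : Prop :=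
  ¬ IsApex G ∧
    ∀ (W : Type) (H : SimpleGraph W), H.IsMinorOf G → IsEmpty (H ≃g G) → IsApex H

/-- Subdivide the edge `uv` of `G`: the new vertex is `none`. -/
def subdivideEdge {V : Type} (G : SimpleGraph V) (u v : V) : SimpleGraph (Option V) :=
  SimpleGraph.fromRel (fun x y =>
    (∃ a b, x = some a ∧ y = some b ∧ G.Adj a b ∧ s(a, b) ≠ s(u, v)) ∨
    (x = none ∧ (y = some u ∨ y = some v)))

/-- `IsSubdivision G H` : `H` is (isomorphic to) a graph obtained from `G` by repeatedly
subdividing edges. -/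
inductive IsSubdivision : {V : Type} → SimpleGraph V → {W : Type} → SimpleGraph W → Prop
  | of_iso {V W : Type} {G : SimpleGraph V} {H : SimpleGraph W} :
      (G ≃g H) → IsSubdivision G H
  | step {V W U : Type} {G : SimpleGraph V} {H : SimpleGraph W} {u v : W}
      {H' : SimpleGraph U} :
      H.Adj u v → IsSubdivision G H → (subdivideEdge H u v ≃g H') → IsSubdivision G H'

/-- A Kuratowski subgraph of `G` is a subgraph that is a subdivision of `K₅` or `K_{3,3}`. -/
def IsKuratowski {V : Type} {G : SimpleGraph V} (H : G.Subgraph) : Prop :=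
  IsSubdivision K5 H.coe ∨ IsSubdivision K33 H.coe

/-- A Kuratowski witness for `v` is a Kuratowski subgraph of `G` avoiding `v`. -/
def IsKuratowskiWitness {V : Type} (G : SimpleGraph V) (v : V) (H : G.Subgraph) : Prop :=
  IsKuratowski H ∧ v ∉ H.verts

/-- A branch vertex of a (Kuratowski) subgraph: a vertex of degree at least 3 in it. -/
def IsBranchVertex {V : Type} {G : SimpleGraph V} (H : G.Subgraph) (x : V) : Prop :=
  x ∈ H.verts ∧ 3 ≤ (H.neighborSet x).ncard

/-- The vertex connectivity of a finite graph: the largest `k` such that deleting any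
fewer than `k` vertices leaves a connected graph. -/
noncomputable def vConn {V : Type} [Fintype V] (G : SimpleGraph V) : ℕ :=
  sSup {k : ℕ | ∀ s : Finset V, s.card < k → (G.induce ((↑s : Set V)ᶜ)).Connected}

/-- A 2-cut: a set of two vertices whose deletion disconnects the graph. -/
def IsTwoCut {V : Type} (G : SimpleGraph V) (S : Set V) : Prop :=
  S.ncard = 2 ∧ ¬ (G.induce Sᶜ).Preconnected

/-- `C` is (the vertex set of) a connected component of `G − S`. -/
def IsCompOf {V : Type} (G : SimpleGraph V) (S : Set V) (C : Set V) : Prop :=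
  C.Nonempty ∧ Disjoint C S ∧ (G.induce C).Connected ∧
    ∀ u ∈ C, ∀ v, v ∉ S → G.Adj u v → v ∈ C

/-- The augmented component `C⁺`: the subgraph induced by `C ∪ S` together with all
edges joining vertices of `S`. -/
def augment {V : Type} (G : SimpleGraph V) (S C : Set V) : SimpleGraph ↥(C ∪ S) :=
  SimpleGraph.fromRel (fun u v => G.Adj (u : V) (v : V) ∨ ((u : V) ∈ S ∧ (v : V) ∈ S))

/-- `C` is a heavy component for the 2-cut `{a,b}`: a component of `G − {a,b}` whose
augmentation contains Kuratowski witnesses for both `a` and `b`. -/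
def IsHeavyComp {V : Type} (G : SimpleGraph V) (a b : V) (C : Set V) : Prop :=
  IsCompOf G {a, b} C ∧
    (∃ Ha : G.Subgraph, IsKuratowskiWitness G a Ha ∧ Ha.verts ⊆ C ∪ {a, b}) ∧
    (∃ Hb : G.Subgraph, IsKuratowskiWitness G b Hb ∧ Hb.verts ⊆ C ∪ {a, b})

/-- `{a,b}` is a basic 2-cut with heavy component `C`: a 2-cut whose heavy-component
weight is minimum among all 2-cuts. -/
def IsBasic2Cut {V : Type} (G : SimpleGraph V) (a b : V) (C : Set V) : Prop :=
  IsTwoCut G {a, b} ∧ IsHeavyComp G a b C ∧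
    ∀ c d : V, ∀ D : Set V, IsTwoCut G {c, d} → IsHeavyComp G c d D → C.ncard ≤ D.ncard

/-- The subgraph of `G` induced by `A`, kept on the same vertex set (vertices outside `A`
become isolated). -/
def restrictTo {V : Type} (G : SimpleGraph V) (A : Set V) : SimpleGraph V :=
  SimpleGraph.fromRel (fun u v => G.Adj u v ∧ u ∈ A ∧ v ∈ A)

/-- Contract the edge `uv` of `G`, keeping the label `u` for the merged vertex
(`v` becomes isolated). -/
def contractEdge {V : Type} (G : SimpleGraph V) (u v : V) : SimpleGraph V :=
  SimpleGraph.fromRel (fun x y =>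
    x ≠ v ∧ y ≠ v ∧ (G.Adj x y ∨ (x = u ∧ G.Adj v y) ∨ (y = u ∧ G.Adj x v)))

/-- `T` separates `a` from `b` in `G`: `a, b ∉ T` and every walk from `a` to `b`
meets `T`. -/
def Separates {V : Type} (G : SimpleGraph V) (T : Set V) (a b : V) : Prop :=
  a ∉ T ∧ b ∉ T ∧ ∀ p : G.Walk a b, ∃ t ∈ T, t ∈ p.support

/-- Disjoint union of two graphs. -/
def disjUnion {V W : Type} (G : SimpleGraph V) (H : SimpleGraph W) : SimpleGraph (V ⊕ W) :=
  SimpleGraph.fromRel (fun x y =>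
    (∃ a b, x = Sum.inl a ∧ y = Sum.inl b ∧ G.Adj a b) ∨
    (∃ a b, x = Sum.inr a ∧ y = Sum.inr b ∧ H.Adj a b))

/-- The graph on `Fin n` with the given list of edges. -/
def graphOfList (n : ℕ) (l : List (ℕ × ℕ)) : SimpleGraph (Fin n) :=
  SimpleGraph.fromRel (fun i j => ((i : ℕ), (j : ℕ)) ∈ l)

/-- A graph is 2-connected: at least three vertices and no cut vertex. -/
def IsTwoConnectedGraph {U : Type} (H : SimpleGraph U) : Prop :=
  3 ≤ Nat.card U ∧ ∀ u : U, (H.induce {x | x ≠ u}).Connected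

/-- `S` induces a connected subgraph, phrased through adjacency-closed subsets. -/
def ConnSet {V : Type} (G : SimpleGraph V) (S : Set V) : Prop :=
  S.Nonempty ∧ ∀ T ⊆ S, T.Nonempty → (∀ x ∈ T, ∀ y ∈ S, G.Adj x y → y ∈ T) → S ⊆ T

/-- The subgraph of `H` induced by `S` is a minor of the subgraph of `G` induced by `T`. -/
def MinorIn {W V : Type} (H : SimpleGraph W) (S : Set W) (G : SimpleGraph V) (T : Set V) : Prop :=
  ∃ f : W → Set V,
    (∀ w ∈ S, f w ⊆ T) ∧ (∀ w ∈ S, ConnSet G (f w)) ∧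
    (∀ w ∈ S, ∀ w' ∈ S, w ≠ w' → Disjoint (f w) (f w')) ∧
    (∀ w ∈ S, ∀ w' ∈ S, H.Adj w w' → ∃ u ∈ f w, ∃ v ∈ f w', G.Adj u v)

/-- The subgraph of `G` induced by `S` is not planar. -/
def NonplanarOn {V : Type} (G : SimpleGraph V) (S : Set V) : Prop :=
  MinorIn K5 Set.univ G S ∨ MinorIn K33 Set.univ G S

lemma connSet_singleton {V : Type} (G : SimpleGraph V) (x : V) : ConnSet G {x} := by
  refine ⟨⟨x, rfl⟩, fun T hT hne _ => ?_⟩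
  obtain ⟨y, hy⟩ := hne
  have := hT hy
  simp only [Set.mem_singleton_iff] at this
  subst this
  simpa using hy

lemma connSet_iff {V : Type} (G : SimpleGraph V) (S : Set V) :
    ConnSet G S ↔ (G.induce S).Connected := by
  constructor
  · rintro ⟨⟨x, hx⟩, h⟩
    have : Nonempty S := ⟨⟨x, hx⟩⟩
    refine ⟨fun p q => ?_⟩
    have := h {y | ∃ hy : y ∈ S, (G.induce S).Reachable p ⟨y, hy⟩} (fun y hy => hy.1)
      ⟨p.1, p.2, Reachable.refl _⟩ ?_ q.2
    · exact this.2
    · rintro y ⟨hy, hr⟩ t ht hyt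
      refine ⟨ht, hr.trans (Adj.reachable ?_)⟩
      simpa using hyt
  · intro h
    obtain ⟨p⟩ := h.nonempty
    refine ⟨⟨p.1, p.2⟩, fun T hT ⟨x, hx⟩ hcl y hy => ?_⟩
    obtain ⟨w⟩ := h.preconnected ⟨x, hT hx⟩ ⟨y, hy⟩
    have key : ∀ (p q : S), (G.induce S).Walk p q → p.1 ∈ T → q.1 ∈ T := by
      intro p q w
      induction w with
      | nil => exact id
      | cons hadj _ ih => exact fun hp => ih (hcl _ hp _ (Subtype.coe_prop _) (by simpa using hadj))
    exact key _ _ w hx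

lemma exists_component {V : Type} (G : SimpleGraph V) {S : Set V} {a : V} (ha : a ∈ S) :
    ∃ X ⊆ S, a ∈ X ∧ ConnSet G X ∧ ∀ x ∈ X, ∀ y ∈ S, G.Adj x y → y ∈ X := by
  let X : Set V := {y | ∀ T ⊆ S, a ∈ T → (∀ x ∈ T, ∀ y ∈ S, G.Adj x y → y ∈ T) → y ∈ T}
  have hXS : X ⊆ S := fun y hy => hy S subset_rfl ha (fun _ _ _ h _ => h)
  have haX : a ∈ X := fun T _ h _ => h
  have hcl : ∀ x ∈ X, ∀ y ∈ S, G.Adj x y → y ∈ X :=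
    fun x hx y hy hxy T hT haT hTc => hTc x (hx T hT haT hTc) y hy hxy
  refine ⟨X, hXS, haX, ⟨⟨a, haX⟩, fun T hT hne hTc => ?_⟩, hcl⟩
  by_cases haT : a ∈ T
  · intro y hy
    exact hy T (hT.trans hXS) haT fun x hx y hy hxy => hTc x hx y (hcl x (hT hx) y hy hxy) hxy
  · obtain ⟨t, ht⟩ := hne
    refine absurd ht (hT ht (X \ T) (Set.sdiff_subset.trans hXS) ⟨haX, haT⟩ ?_).2
    rintro x ⟨hx, hxT⟩ y hy hxy
    exact ⟨hcl x hx y hy hxy, fun hyT => hxT (hTc y hyT x hx hxy.symm)⟩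

lemma MinorIn.trans {U V W : Type} {F : SimpleGraph U} {R : Set U} {G : SimpleGraph V} {S : Set V}
    {H : SimpleGraph W} {T : Set W} (h₁ : MinorIn F R G S) (h₂ : MinorIn G S H T) :
    MinorIn F R H T := by
  obtain ⟨f, fS, fc, fd, fa⟩ := h₁
  obtain ⟨g, gT, gc, gd, ga⟩ := h₂
  refine ⟨fun w => ⋃ s ∈ f w, g s, ?_, ?_, ?_, ?_⟩
  · intro w hw
    exact Set.iUnion₂_subset fun s hs => gT s (fS w hw hs)
  · intro w hw
    obtain ⟨⟨s, hs⟩, hc⟩ := fc w hw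
    obtain ⟨t, ht⟩ := (gc s (fS w hw hs)).1
    refine ⟨⟨t, Set.mem_biUnion hs ht⟩, fun X hX ⟨x, hx⟩ hcl => ?_⟩
    have full : ∀ r ∈ f w, ∀ x ∈ g r, x ∈ X → g r ⊆ X := by
      intro r hr x hxr hxX
      exact ((gc r (fS w hw hr)).2 (g r ∩ X) Set.inter_subset_left ⟨x, hxr, hxX⟩
        fun p hp q hq hpq => ⟨hq, hcl p hp.2 q (Set.mem_biUnion hr hq) hpq⟩).trans
          Set.inter_subset_right
    obtain ⟨r, hr, hxr⟩ := Set.mem_iUnion₂.1 (hX hx)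
    have := hc {r ∈ f w | g r ⊆ X} (fun r hr => hr.1) ⟨r, hr, full r hr x hxr hx⟩ ?_
    · exact Set.iUnion₂_subset fun r hr => (this hr).2
    · rintro p ⟨hp, hpX⟩ q hq hpq
      obtain ⟨u, hu, v, hv, huv⟩ := ga p (fS w hw hp) q (fS w hw hq) hpq
      exact ⟨hq, full q hq v hv (hcl u (hpX hu) v (Set.mem_biUnion hq hv) huv)⟩
  · intro w hw w' hw' hne
    refine Set.disjoint_left.2 fun x hx hx' => ?_
    obtain ⟨s, hs, hxs⟩ := Set.mem_iUnion₂.1 hx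
    obtain ⟨t, ht, hxt⟩ := Set.mem_iUnion₂.1 hx'
    have hst : s ≠ t := by
      rintro rfl
      exact Set.disjoint_left.1 (fd w hw w' hw' hne) hs ht
    exact Set.disjoint_left.1 (gd s (fS w hw hs) t (fS w' hw' ht) hst) hxs hxt
  · intro w hw w' hw' hadj
    obtain ⟨s, hs, t, ht, hst⟩ := fa w hw w' hw' hadj
    obtain ⟨u, hu, v, hv, huv⟩ := ga s (fS w hw hs) t (fS w' hw' ht) hst
    exact ⟨u, Set.mem_biUnion hs hu, v, Set.mem_biUnion ht hv, huv⟩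

lemma MinorIn.of_map {W V : Type} {H : SimpleGraph W} {S : Set W} {G : SimpleGraph V} {T : Set V}
    (g : W → V) (hT : ∀ w ∈ S, g w ∈ T) (hinj : ∀ w ∈ S, ∀ w' ∈ S, g w = g w' → w = w')
    (hadj : ∀ w ∈ S, ∀ w' ∈ S, H.Adj w w' → G.Adj (g w) (g w')) : MinorIn H S G T := by
  refine ⟨fun w => {g w}, ?_, fun w _ => connSet_singleton G _, ?_, ?_⟩
  · intro w hw
    simpa using hT w hw
  · intro w hw w' hw' hne
    simpa using fun h => hne (hinj w hw w' hw' h)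
  · intro w hw w' hw' h
    exact ⟨_, rfl, _, rfl, hadj w hw w' hw' h⟩

/-- Blow up a single vertex `c` into a connected set `X`, leaving the others in place. -/
lemma MinorIn.of_expand {V : Type} {H G : SimpleGraph V} {S T : Set V} (c : V) (X : Set V)
    (hX : ConnSet G X) (hXT : X ⊆ T) (hST : ∀ s ∈ S, s ≠ c → s ∈ T)
    (hdisj : ∀ s ∈ S, s ≠ c → s ∉ X)
    (hc : ∀ s ∈ S, s ≠ c → H.Adj c s → ∃ x ∈ X, G.Adj x s)
    (hadj : ∀ s ∈ S, ∀ t ∈ S, s ≠ c → t ≠ c → H.Adj s t → G.Adj s t) : MinorIn H S G T := by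
  classical
  refine ⟨fun s => if s = c then X else {s}, ?_, ?_, ?_, ?_⟩
  · intro s hs
    by_cases h : s = c
    · simpa [h] using hXT
    · simpa [h] using hST s hs h
  · intro s hs
    by_cases h : s = c
    · simpa [h] using hX
    · simpa [h] using connSet_singleton G s
  · intro s hs t ht hne
    by_cases h : s = c <;> by_cases h' : t = c
    · exact absurd (h.trans h'.symm) hne
    · simpa [h, h'] using hdisj t ht h'
    · simpa [h, h'] using hdisj s hs h
    · simpa [h, h'] using hne
  · intro s hs t ht hst
    by_cases h : s = c <;> by_cases h' : t = c
    · exact absurd (h.trans h'.symm) hst.ne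
    · subst h
      obtain ⟨x, hx, hxt⟩ := hc t ht h' hst
      exact ⟨x, by simpa using hx, t, by simp [h'], hxt⟩
    · subst h'
      obtain ⟨x, hx, hxt⟩ := hc s hs h hst.symm
      exact ⟨s, by simp [h], x, by simpa using hx, hxt.symm⟩
    · exact ⟨s, by simp [h], t, by simp [h'], hadj s hs t ht h h' hst⟩

lemma isMinorOf_iff {W V : Type} (H : SimpleGraph W) (G : SimpleGraph V) :
    H.IsMinorOf G ↔ MinorIn H Set.univ G Set.univ := by
  simp [SimpleGraph.IsMinorOf, MinorIn, connSet_iff, Pairwise]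

lemma minorIn_induce {V : Type} (G : SimpleGraph V) (S : Set V) :
    MinorIn (G.induce S) Set.univ G S :=
  MinorIn.of_map Subtype.val (fun w _ => w.2) (fun _ _ _ _ h => Subtype.ext h)
    (fun _ _ _ _ h => by simpa using h)

lemma minorIn_induce' {V : Type} (G : SimpleGraph V) (S : Set V) :
    MinorIn G S (G.induce S) Set.univ := by
  refine ⟨fun x => {y | y.1 = x}, fun _ _ => Set.subset_univ _, ?_, ?_, ?_⟩
  · intro x hx
    have : {y : S | y.1 = x} = {⟨x, hx⟩} := by
      ext y
      simp [Subtype.ext_iff]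
    simpa only [this] using connSet_singleton _ _
  · intro x _ y _ hne
    exact Set.disjoint_left.2 fun z hz hz' => hne (hz.symm.trans hz')
  · intro x hx y hy h
    exact ⟨⟨x, hx⟩, rfl, ⟨y, hy⟩, rfl, by simpa using h⟩

lemma NonplanarOn.trans {U V : Type} {G : SimpleGraph V} {S : Set V} {H : SimpleGraph U}
    {T : Set U} (h : NonplanarOn G S) (hm : MinorIn G S H T) : NonplanarOn H T :=
  h.imp (fun h => h.trans hm) (fun h => h.trans hm)

lemma NonplanarOn.mono {V : Type} {G H : SimpleGraph V} {S T : Set V} (h : NonplanarOn G S)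
    (hST : S ⊆ T) (hadj : ∀ x ∈ S, ∀ y ∈ S, G.Adj x y → H.Adj x y) : NonplanarOn H T :=
  h.trans (MinorIn.of_map id (fun _ hw => hST hw) (fun _ _ _ _ h => h) hadj)

lemma not_isPlanar_iff {V : Type} (G : SimpleGraph V) : ¬ IsPlanar G ↔ NonplanarOn G Set.univ := by
  rw [IsPlanar, isMinorOf_iff, isMinorOf_iff, NonplanarOn]
  tauto

lemma not_isPlanar_induce_iff {V : Type} (G : SimpleGraph V) (S : Set V) :
    ¬ IsPlanar (G.induce S) ↔ NonplanarOn G S := by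
  rw [not_isPlanar_iff]
  exact ⟨fun h => h.trans (minorIn_induce G S), fun h => h.trans (minorIn_induce' G S)⟩

lemma K33_common_neighbors : ∀ x y : Fin 6, x ≠ y → ¬ K33.Adj x y → ∃ s t r : Fin 6,
    s ≠ t ∧ s ≠ r ∧ t ≠ r ∧ K33.Adj x s ∧ K33.Adj x t ∧ K33.Adj x r ∧
      K33.Adj y s ∧ K33.Adj y t ∧ K33.Adj y r := by
  intro x y hne hnadj
  simp only [K33, SimpleGraph.fromRel_adj, ne_eq, Fin.ext_iff] at hne hnadj ⊢
  by_cases hx : x.val < 3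
  · exact ⟨3, 4, 5, by simp; omega⟩
  · exact ⟨0, 1, 2, by simp; omega⟩

lemma K33_exists_adj : ∀ x : Fin 6, ∃ y, K33.Adj x y := by
  simp only [K33, SimpleGraph.fromRel_adj]
  decide

lemma K5_exists_adj : ∀ x : Fin 5, ∃ y, K5.Adj x y := by
  simp only [K5, SimpleGraph.top_adj]
  decide

lemma MinorIn.inter_of_exists_adj {W V : Type} {H : SimpleGraph W} {G : SimpleGraph V} {S U : Set V}
    (hH : ∀ x, ∃ y, H.Adj x y) (hU : ∀ x ∈ S, ∀ y ∈ S, G.Adj x y → x ∈ U)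
    (h : MinorIn H Set.univ G S) : MinorIn H Set.univ G (S ∩ U) := by
  obtain ⟨f, fS, fc, fd, fa⟩ := h
  refine ⟨f, fun w hw x hx => ⟨fS w hw hx, ?_⟩, fc, fd, fa⟩
  by_contra hxU
  obtain ⟨w', hw'⟩ := hH w
  have hsub := (fc w hw).2 {x} (by simpa using hx) ⟨x, rfl⟩ (by
    rintro y rfl t ht hyt
    exact absurd (hU _ (fS w hw hx) _ (fS w hw ht) hyt) hxU)
  obtain ⟨u, hu, v, hv, huv⟩ := fa w hw w' trivial hw'
  obtain rfl := hsub hu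
  exact hxU (hU _ (fS w hw hu) _ (fS w' trivial hv) huv)

/-- Isolated vertices are irrelevant to planarity. -/
lemma NonplanarOn.inter {V : Type} {G : SimpleGraph V} {S U : Set V} (h : NonplanarOn G S)
    (hU : ∀ x ∈ S, ∀ y ∈ S, G.Adj x y → x ∈ U) : NonplanarOn G (S ∩ U) :=
  h.imp (MinorIn.inter_of_exists_adj K5_exists_adj hU)
    (MinorIn.inter_of_exists_adj K33_exists_adj hU)

lemma MinorIn.exists_injective {W V : Type} {H : SimpleGraph W} {G : SimpleGraph V} {S : Set V}
    (h : MinorIn H Set.univ G S) : ∃ g : W → V, Function.Injective g ∧ ∀ w, g w ∈ S := by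
  obtain ⟨f, fS, fc, fd, -⟩ := h
  choose g hg using fun w => (fc w trivial).1
  refine ⟨g, fun w w' hww => ?_, fun w => fS w trivial (hg w)⟩
  by_contra hne
  exact Set.disjoint_left.1 (fd w trivial w' trivial hne) (hg w) (hww ▸ hg w')

lemma NonplanarOn.not_subset {V : Type} {G : SimpleGraph V} {S : Set V} (h : NonplanarOn G S)
    (x y z : V) : ∃ w ∈ S, w ≠ x ∧ w ≠ y ∧ w ≠ z := by
  classical
  by_contra! hcon
  have aux : ∀ n, 4 ≤ n → ∀ g : Fin n → V, Function.Injective g → (∀ w, g w ∈ S) → False := by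
    intro n hn g hg hS
    have h1 : (Finset.univ.image g) ⊆ {x, y, z} := by
      intro v hv
      obtain ⟨w, -, rfl⟩ := Finset.mem_image.1 hv
      have := hcon _ (hS w)
      simp only [Finset.mem_insert, Finset.mem_singleton]
      tauto
    have h2 := Finset.card_le_card h1
    rw [Finset.card_image_of_injective _ hg, Finset.card_univ, Fintype.card_fin] at h2
    have := Finset.card_le_three (a := x) (b := y) (c := z)
    omega
  obtain h | h := h
  · obtain ⟨g, hg, hS⟩ := h.exists_injective
    exact aux 5 (by norm_num) g hg hS
  · obtain ⟨g, hg, hS⟩ := h.exists_injective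
    exact aux 6 (by norm_num) g hg hS

lemma ConnSet.inter_of_separation {V : Type} {G : SimpleGraph V} {F A B : Set V} {p q : V}
    (hF : F ⊆ A ∪ B) (hAB : A ∩ B = {p, q})
    (hno : ∀ x ∈ F, x ∈ A → x ∉ B → ∀ y ∈ F, y ∈ B → y ∉ A → ¬ G.Adj x y)
    (hc : ConnSet G F) (hside : p ∈ F ∨ q ∈ F ∨ ∀ x ∈ F, x ∈ A ∧ x ∉ B) :
    ConnSet (G ⊔ edge p q) (F ∩ A) := by
  have hp : p ∈ A ∩ B := by rw [hAB]; simp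
  have hq : q ∈ A ∩ B := by rw [hAB]; simp
  have hpq : ∀ x, x ∈ A → x ∈ B → x = p ∨ x = q := by
    intro x hx hx'
    have : x ∈ A ∩ B := ⟨hx, hx'⟩
    simpa [hAB] using this
  refine ⟨?_, fun T hT hne hcl => ?_⟩
  · obtain h | h | h := hside
    · exact ⟨p, h, hp.1⟩
    · exact ⟨q, h, hq.1⟩
    · obtain ⟨x, hx⟩ := hc.1
      exact ⟨x, hx, (h x hx).1⟩
  have hclG : ∀ x ∈ T, ∀ y ∈ F, y ∈ A → G.Adj x y → y ∈ T :=
    fun x hx y hy hyA h => hcl x hx y ⟨hy, hyA⟩ (Or.inl h)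
  have absorb : (p ∈ F → p ∈ T) → (q ∈ F → q ∈ T) → F ∩ A ⊆ T := by
    intro h1 h2
    have := hc.2 (T ∪ (F \ A)) (Set.union_subset (fun x hx => (hT hx).1) Set.sdiff_subset)
      (hne.mono Set.subset_union_left) ?_
    · intro x hx
      obtain h | h := this hx.1
      · exact h
      · exact absurd hx.2 h.2
    · intro x hx y hy hxy
      by_cases hyA : y ∈ A
      · left
        obtain hx | hx := hx
        · exact hclG x hx y hy hyA hxy
        · have hyB : y ∈ B := by
            by_contra hyB
            exact hno y hy hyA hyB x hx.1 ((hF hx.1).resolve_left hx.2) hx.2 hxy.symm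
          obtain rfl | rfl := hpq y hyA hyB
          · exact h1 hy
          · exact h2 hy
      · exact Or.inr ⟨hy, hyA⟩
  by_cases hpT : p ∈ T <;> by_cases hqT : q ∈ T
  · exact absorb (fun _ => hpT) (fun _ => hqT)
  · refine absorb (fun _ => hpT) (fun hqF => ?_)
    refine hcl p hpT q ⟨hqF, hq.1⟩ (Or.inr ?_)
    rw [edge_adj]
    exact ⟨Or.inl ⟨rfl, rfl⟩, fun h => hqT (h ▸ hpT)⟩
  · refine absorb (fun hpF => ?_) (fun _ => hqT)
    refine hcl q hqT p ⟨hpF, hp.1⟩ (Or.inr ?_)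
    rw [edge_adj]
    exact ⟨Or.inr ⟨rfl, rfl⟩, fun h => hpT (h ▸ hqT)⟩
  · refine Set.inter_subset_left.trans
      (hc.2 T (hT.trans Set.inter_subset_left) hne fun x hx y hy hxy => ?_)
    by_cases hyA : y ∈ A
    · exact hclG x hx y hy hyA hxy
    · have hxB : x ∉ B := by
        intro hxB
        obtain rfl | rfl := hpq x (hT hx).2 hxB
        · exact hpT hx
        · exact hqT hx
      exact absurd hxy (hno x (hT hx).1 (hT hx).2 hxB y hy ((hF hy).resolve_left hyA) hyA)

/-- A minor model all of whose branch sets meet the cut or lie on one side survives on that side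
after adding the virtual edge. -/
lemma minorIn_side_of_separation {W V : Type} {H : SimpleGraph W} {G : SimpleGraph V}
    {S A B : Set V} {p q : V} (hS : S ⊆ A ∪ B) (hAB : A ∩ B = {p, q})
    (hno : ∀ x ∈ S, x ∈ A → x ∉ B → ∀ y ∈ S, y ∈ B → y ∉ A → ¬ G.Adj x y) {f : W → Set V}
    (fS : ∀ w, f w ⊆ S) (fc : ∀ w, ConnSet G (f w))
    (fd : ∀ w w', w ≠ w' → Disjoint (f w) (f w'))
    (fa : ∀ w w', H.Adj w w' → ∃ u ∈ f w, ∃ v ∈ f w', G.Adj u v)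
    (hside : ∀ w, p ∈ f w ∨ q ∈ f w ∨ ∀ x ∈ f w, x ∈ A ∧ x ∉ B) :
    MinorIn H Set.univ (G ⊔ edge p q) (S ∩ A) := by
  have hp : p ∈ A ∩ B := by rw [hAB]; simp
  have hq : q ∈ A ∩ B := by rw [hAB]; simp
  refine ⟨fun w => f w ∩ A, fun w _ => Set.inter_subset_inter_left _ (fS w), ?_, ?_, ?_⟩
  · intro w _
    exact (fc w).inter_of_separation ((fS w).trans hS) hAB
      (fun x hx hxA hxB y hy => hno x (fS w hx) hxA hxB y (fS w hy)) (hside w)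
  · intro w _ w' _ hne
    exact (fd w w' hne).mono Set.inter_subset_left Set.inter_subset_left
  · intro w _ w' _ hww
    obtain ⟨u, hu, v, hv, huv⟩ := fa w w' hww
    have disj : ∀ x, x ∈ f w → x ∉ f w' := fun x h h' =>
      Set.disjoint_left.1 (fd w w' hww.ne) h h'
    have cross : (p ∈ f w ∨ q ∈ f w) → (p ∈ f w' ∨ q ∈ f w') →
        ∃ u ∈ f w ∩ A, ∃ v ∈ f w' ∩ A, (G ⊔ edge p q).Adj u v := by
      rintro (h | h) (h' | h')
      · exact absurd h' (disj p h)
      · exact ⟨p, ⟨h, hp.1⟩, q, ⟨h', hq.1⟩, Or.inr ((edge_adj _ _ _ _).2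
          ⟨Or.inl ⟨rfl, rfl⟩, fun e => disj p h (e ▸ h')⟩)⟩
      · exact ⟨q, ⟨h, hq.1⟩, p, ⟨h', hp.1⟩, Or.inr ((edge_adj _ _ _ _).2
          ⟨Or.inr ⟨rfl, rfl⟩, fun e => disj q h (e ▸ h')⟩)⟩
      · exact absurd h' (disj q h)
    have meets : ∀ w, ∀ x ∈ f w, (x ∉ A ∨ x ∈ B) → p ∈ f w ∨ q ∈ f w := by
      intro w x hx hxA
      obtain h | h | h := hside w
      · exact Or.inl h
      · exact Or.inr h
      · have := h x hx
        tauto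
    by_cases hboth : u ∈ A ∧ v ∈ A
    · exact ⟨u, ⟨hu, hboth.1⟩, v, ⟨hv, hboth.2⟩, Or.inl huv⟩
    · have h1 := hno u (fS w hu)
      have h2 := hno v (fS w' hv)
      have hu' := hS (fS w hu)
      have hv' := hS (fS w' hv)
      rw [Set.mem_union] at hu' hv'
      have h3 : u ∈ A → v ∉ A → u ∈ B := fun hA hA' => by
        by_contra hB
        exact h1 hA hB v (fS w' hv) (hv'.resolve_left hA') hA' huv
      have h4 : v ∈ A → u ∉ A → v ∈ B := fun hA hA' => by
        by_contra hB
        exact h2 hA hB u (fS w hu) (hu'.resolve_left hA') hA' huv.symm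
      exact cross (meets w u hu (by tauto)) (meets w' v hv (by tauto))

lemma MinorIn.of_separation {W V : Type} {H : SimpleGraph W} {G : SimpleGraph V}
    {S A B : Set V} {p q : V}
    (hH : ∀ x y, x ≠ y → ¬ H.Adj x y → ∃ s t r, s ≠ t ∧ s ≠ r ∧ t ≠ r ∧ H.Adj x s ∧ H.Adj x t ∧
      H.Adj x r ∧ H.Adj y s ∧ H.Adj y t ∧ H.Adj y r)
    (hS : S ⊆ A ∪ B) (hAB : A ∩ B = {p, q})
    (hno : ∀ x ∈ S, x ∈ A → x ∉ B → ∀ y ∈ S, y ∈ B → y ∉ A → ¬ G.Adj x y)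
    (h : MinorIn H Set.univ G S) :
    MinorIn H Set.univ (G ⊔ edge p q) (S ∩ A) ∨ MinorIn H Set.univ (G ⊔ edge p q) (S ∩ B) := by
  obtain ⟨f, fS, fc, fd, fa⟩ := h
  replace fS := fun w => fS w trivial
  replace fc := fun w => fc w trivial
  replace fd := fun w w' => fd w trivial w' trivial
  replace fa := fun w w' => fa w trivial w' trivial
  have hpq : ∀ x, x ∈ A → x ∈ B → x = p ∨ x = q := by
    intro x hx hx'
    have : x ∈ A ∩ B := ⟨hx, hx'⟩
    simpa [hAB] using this
  have side : ∀ w, p ∉ f w → q ∉ f w →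
      (∀ x ∈ f w, x ∈ A ∧ x ∉ B) ∨ ∀ x ∈ f w, x ∈ B ∧ x ∉ A := by
    intro w hp hq
    have notboth : ∀ x ∈ f w, x ∈ A → x ∉ B := by
      intro x hx hxA hxB
      obtain rfl | rfl := hpq x hxA hxB
      · exact hp hx
      · exact hq hx
    by_cases hne : (f w ∩ A).Nonempty
    · left
      have := (fc w).2 (f w ∩ A) Set.inter_subset_left hne ?_
      · exact fun x hx => ⟨(this hx).2, notboth x hx (this hx).2⟩
      · rintro x ⟨hx, hxA⟩ y hy hxy
        refine ⟨hy, ?_⟩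
        by_contra hyA
        exact hno x (fS w hx) hxA (notboth x hx hxA) y (fS w hy)
          ((hS (fS w hy)).resolve_left hyA) hyA hxy
    · right
      intro x hx
      have hxA : x ∉ A := fun hxA => hne ⟨x, hx, hxA⟩
      exact ⟨(hS (fS w hx)).resolve_left hxA, hxA⟩
  have noadj : ∀ w w', (∀ x ∈ f w, x ∈ A ∧ x ∉ B) → (∀ x ∈ f w', x ∈ B ∧ x ∉ A) →
      ¬ H.Adj w w' := by
    intro w w' hw hw' hadj
    obtain ⟨u, hu, v, hv, huv⟩ := fa w w' hadj
    exact hno u (fS w hu) (hw u hu).1 (hw u hu).2 v (fS w' hv) (hw' v hv).1 (hw' v hv).2 huv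
  by_cases hall : ∀ w, p ∈ f w ∨ q ∈ f w ∨ ∀ x ∈ f w, x ∈ A ∧ x ∉ B
  · exact Or.inl (minorIn_side_of_separation hS hAB hno fS fc fd fa hall)
  right
  push Not at hall
  obtain ⟨w₀, hp₀, hq₀, x₀, hx₀, hxA₀⟩ := hall
  have hw₀ : ∀ x ∈ f w₀, x ∈ B ∧ x ∉ A :=
    (side w₀ hp₀ hq₀).resolve_left fun h => hxA₀ (h x₀ hx₀).1 |> (h x₀ hx₀).2
  refine minorIn_side_of_separation (by rwa [Set.union_comm]) (by rwa [Set.inter_comm])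
    (fun x hx hxB hxA y hy hyA hyB hxy => hno y hy hyA hyB x hx hxB hxA hxy.symm) fS fc fd fa ?_
  intro w
  by_contra! hcon
  obtain ⟨hp, hq, x, hx, hxB⟩ := hcon
  have hw : ∀ x ∈ f w, x ∈ A ∧ x ∉ B :=
    (side w hp hq).resolve_right fun h => (h x hx).2 (hxB (h x hx).1)
  have hne : w ≠ w₀ := by
    rintro rfl
    exact (hw₀ x hx).2 (hw x hx).1
  obtain ⟨s, t, r, hst, hsr, htr, h1, h2, h3, h4, h5, h6⟩ := hH w w₀ hne (noadj w w₀ hw hw₀)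
  have bad : ∀ s, H.Adj w s → H.Adj w₀ s → p ∈ f s ∨ q ∈ f s := by
    intro s hs hs'
    by_contra! hcon
    obtain h | h := side s hcon.1 hcon.2
    · exact noadj s w₀ h hw₀ hs'.symm
    · exact noadj w s hw h hs
  have uniq : ∀ z s t, s ≠ t → z ∈ f s → z ∉ f t := fun z s t hne h h' =>
    Set.disjoint_left.1 (fd s t hne) h h'
  obtain b1 | b1 := bad s h1 h4 <;> obtain b2 | b2 := bad t h2 h5 <;>
    obtain b3 | b3 := bad r h3 h6 <;>
    first
      | exact uniq _ s t hst b1 b2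
      | exact uniq _ s r hsr b1 b3
      | exact uniq _ t r htr b2 b3

lemma NonplanarOn.of_separation {V : Type} {G : SimpleGraph V} {S A B : Set V} {p q : V}
    (hS : S ⊆ A ∪ B) (hAB : A ∩ B = {p, q})
    (hno : ∀ x ∈ S, x ∈ A → x ∉ B → ∀ y ∈ S, y ∈ B → y ∉ A → ¬ G.Adj x y)
    (h : NonplanarOn G S) :
    NonplanarOn (G ⊔ edge p q) (S ∩ A) ∨ NonplanarOn (G ⊔ edge p q) (S ∩ B) := by
  obtain h | h := h
  · exact (h.of_separation (fun x y hne hna => absurd hne hna) hS hAB hno).imp Or.inl Or.inl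
  · exact (h.of_separation K33_common_neighbors hS hAB hno).imp Or.inr Or.inr

/-- A nonplanar graph stays nonplanar on one side of a cut vertex. -/
lemma NonplanarOn.of_cutVertex {V : Type} {G : SimpleGraph V} {S A B : Set V} {p : V}
    (hS : S ⊆ A ∪ B) (hAB : A ∩ B = {p})
    (hno : ∀ x ∈ S, x ∈ A → x ∉ B → ∀ y ∈ S, y ∈ B → y ∉ A → ¬ G.Adj x y)
    (h : NonplanarOn G S) : NonplanarOn G (S ∩ A) ∨ NonplanarOn G (S ∩ B) := by
  have := h.of_separation (p := p) (q := p) hS (by simpa using hAB) hno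
  simpa using this

/-- A vertex whose deletion destroys nonplanarity has at least two neighbors. -/
lemma NonplanarOn.exists_adj_ne {V : Type} {G : SimpleGraph V} {S : Set V} {a : V}
    (h : NonplanarOn G S) (ha : ¬ NonplanarOn G (S \ {a})) {x : V} (hxa : x ≠ a) :
    ∃ y ∈ S, y ≠ x ∧ G.Adj a y := by
  by_contra! hcon
  have hAB : ({a, x} : Set V) ∩ {a}ᶜ = {x} := by
    ext y
    simp only [Set.mem_inter_iff, Set.mem_insert_iff, Set.mem_singleton_iff, Set.mem_compl_iff]
    constructor
    · tauto
    · rintro rfl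
      exact ⟨Or.inr rfl, hxa⟩
  have hS : S ⊆ {a, x} ∪ {a}ᶜ := by
    intro y _
    by_cases h : y = a
    · exact Or.inl (Or.inl h)
    · exact Or.inr h
  obtain h' | h' := h.of_cutVertex hS hAB fun y _ hyA hyB z hz hzB hzA hyz => by
    obtain rfl : y = a := by simpa using hyB
    exact hcon z hz (fun h => hzA (by simp [h])) hyz
  · obtain ⟨w, hw, h1, h2, -⟩ := h'.not_subset a x x
    simp_all
  · exact ha h'

lemma connSet_pair {V : Type} {G : SimpleGraph V} {u v : V} (h : G.Adj u v) :
    ConnSet G {u, v} := by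
  refine ⟨⟨u, by simp⟩, fun T hT ⟨x, hx⟩ hcl => ?_⟩
  obtain rfl | rfl : x = u ∨ x = v := hT hx
  · rintro y (rfl | rfl)
    · exact hx
    · exact hcl x hx y (by simp) h
  · rintro y (rfl | rfl)
    · exact hcl x hx y (by simp) h.symm
    · exact hx

lemma contractEdge_adj {V : Type} {G : SimpleGraph V} {u v x y : V} :
    (contractEdge G u v).Adj x y ↔ x ≠ y ∧ x ≠ v ∧ y ≠ v ∧
      (G.Adj x y ∨ (x = u ∧ G.Adj v y) ∨ (y = u ∧ G.Adj x v)) := by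
  simp only [contractEdge, SimpleGraph.fromRel_adj, G.adj_comm y x, G.adj_comm v x, G.adj_comm y v]
  tauto

lemma contractEdge_adj_of_adj {V : Type} {G : SimpleGraph V} {u v x y : V} (h : G.Adj x y)
    (hx : x ≠ v) (hy : y ≠ v) : (contractEdge G u v).Adj x y :=
  contractEdge_adj.2 ⟨h.ne, hx, hy, Or.inl h⟩

lemma NonplanarOn.contractEdge_diff {V : Type} {G : SimpleGraph V} {u v : V} {S : Set V}
    (h : NonplanarOn (contractEdge G u v) S) : NonplanarOn (contractEdge G u v) (S \ {v}) :=
  h.inter (U := {v}ᶜ) fun _ _ _ _ hxy => (contractEdge_adj.1 hxy).2.1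

lemma minorIn_of_contractEdge {V : Type} {G : SimpleGraph V} {u v : V} {S T : Set V}
    (huv : G.Adj u v) (hST : S ⊆ T) (hu : u ∈ T) (hv : v ∈ T) :
    MinorIn (contractEdge G u v) (S \ {v}) G T := by
  refine MinorIn.of_expand u {u, v} (connSet_pair huv) ?_ (fun s hs _ => hST hs.1) ?_ ?_ ?_
  · rintro x (rfl | rfl) <;> assumption
  · rintro s hs hsu (h | h)
    · exact hsu h
    · exact hs.2 h
  · intro s hs hsu hadj
    obtain ⟨-, -, -, h | h | h⟩ := contractEdge_adj.1 hadj
    · exact ⟨u, by simp, h⟩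
    · exact ⟨v, by simp, h.2⟩
    · exact absurd h.1 hsu
  · intro s _ t _ hs ht hadj
    obtain ⟨-, -, -, h | h | h⟩ := contractEdge_adj.1 hadj
    · exact h
    · exact absurd h.1 hs
    · exact absurd h.1 ht

lemma NonplanarOn.of_contractEdge {V : Type} {G : SimpleGraph V} {u v : V} {S T : Set V}
    (h : NonplanarOn (contractEdge G u v) S) (huv : G.Adj u v) (hST : S ⊆ T) (hu : u ∈ T)
    (hv : v ∈ T) : NonplanarOn G T :=
  h.contractEdge_diff.trans (minorIn_of_contractEdge huv hST hu hv)

/-- Contracting `uv` into `u` or into `v` gives the same graph up to the name of the merged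
vertex. -/
lemma NonplanarOn.contractEdge_swap {V : Type} {G : SimpleGraph V} {u v : V} {S T : Set V}
    (h : NonplanarOn (contractEdge G u v) S) (huv : u ≠ v) (hS : ∀ s ∈ S, s ≠ u → s ≠ v → s ∈ T)
    (hv : v ∈ T) : NonplanarOn (contractEdge G v u) T := by
  refine h.contractEdge_diff.trans (MinorIn.of_expand u {v} (connSet_singleton _ _)
    (by simpa using hv) (fun s hs hsu => hS s hs.1 hsu hs.2) (fun s hs _ => hs.2) ?_ ?_)
  · intro s hs hsu hadj
    refine ⟨v, rfl, contractEdge_adj.2 ⟨Ne.symm hs.2, huv.symm, hsu, ?_⟩⟩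
    obtain ⟨-, -, -, h | h | h⟩ := contractEdge_adj.1 hadj
    · exact Or.inr (Or.inl ⟨rfl, h⟩)
    · exact Or.inl h.2
    · exact absurd h.1 hsu
  · intro s _ t _ hs ht hadj
    obtain ⟨-, -, -, h | h | h⟩ := contractEdge_adj.1 hadj
    · exact contractEdge_adj_of_adj h hs ht
    · exact absurd h.1 hs
    · exact absurd h.1 ht

/-- The facts about the heavy component `C` of `G - {a, b}` and `U = C ∪ {a, b}` used in the
deletion/contraction argument. -/
structure HeavySide {V : Type} (G : SimpleGraph V) (a b : V) (C U : Set V) : Prop where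
  mem_iff : ∀ x, x ∈ U ↔ x = a ∨ x = b ∨ x ∈ C
  ne : a ≠ b
  left_notMem : a ∉ C
  right_notMem : b ∉ C
  not_adj : ∀ x ∈ C, ∀ y, y ∉ U → ¬ G.Adj x y
  cut : ∀ (p q : V) (X : Set V), p ∈ C → p ≠ q → X.Nonempty → p ∉ X → q ∉ X →
    (∀ x ∈ X, ∀ y, G.Adj x y → y ∈ X ∨ y = p ∨ y = q) → ∀ y, y ≠ p → y ≠ q → y ∈ X
  exists_apex_deleteEdges : ∀ u v, G.Adj u v →
    ∃ z, ¬ NonplanarOn (G.deleteEdges {s(u, v)}) {z}ᶜ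
  exists_apex_contractEdge : ∀ u v, G.Adj u v →
    ∃ z, z ≠ v ∧ ¬ NonplanarOn (contractEdge G u v) {z}ᶜ
  nonplanar_light : NonplanarOn (G ⊔ edge a b) Cᶜ
  planar : ¬ NonplanarOn G C

namespace HeavySide

variable {V : Type} {G : SimpleGraph V} {a b : V} {C U : Set V}

lemma symm (h : HeavySide G a b C U) : HeavySide G b a C U where
  mem_iff x := by rw [h.mem_iff]; tauto
  ne := h.ne.symm
  left_notMem := h.right_notMem
  right_notMem := h.left_notMem
  not_adj := h.not_adj
  cut := h.cut
  exists_apex_deleteEdges := h.exists_apex_deleteEdges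
  exists_apex_contractEdge := h.exists_apex_contractEdge
  nonplanar_light := by simpa [edge_comm] using h.nonplanar_light
  planar := h.planar

lemma left_mem (h : HeavySide G a b C U) : a ∈ U := (h.mem_iff a).2 (Or.inl rfl)

lemma right_mem (h : HeavySide G a b C U) : b ∈ U := h.symm.left_mem

lemma mem_of_mem (h : HeavySide G a b C U) {x : V} (hx : x ∈ C) : x ∈ U :=
  (h.mem_iff x).2 (Or.inr (Or.inr hx))

lemma mem_of_ne (h : HeavySide G a b C U) {x : V} (hx : x ∈ U) (ha : x ≠ a) (hb : x ≠ b) :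
    x ∈ C := by
  have := (h.mem_iff x).1 hx
  tauto

lemma ne_left (h : HeavySide G a b C U) {x : V} (hx : x ∈ C) : x ≠ a := by
  rintro rfl
  exact h.left_notMem hx

lemma ne_right (h : HeavySide G a b C U) {x : V} (hx : x ∈ C) : x ≠ b := h.symm.ne_left hx

lemma eq_empty_of_cut (h : HeavySide G a b C U) {p q y : V} {X : Set V} (hp : p ∈ C) (hpq : p ≠ q)
    (hXC : X ⊆ C) (hpX : p ∉ X) (hqX : q ∉ X)
    (hcl : ∀ s ∈ X, ∀ t ∈ U, G.Adj s t → t ∈ X ∨ t = p ∨ t = q)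
    (hyX : y ∉ X) (hyp : y ≠ p) (hyq : y ≠ q) : X = ∅ := by
  by_contra hne
  refine hyX (h.cut p q X hp hpq (Set.nonempty_iff_ne_empty.2 hne) hpX hqX ?_ y hyp hyq)
  intro s hs t hst
  by_cases ht : t ∈ U
  · exact hcl s hs t ht hst
  · exact absurd hst (h.not_adj s (hXC hs) t ht)

/-- If deleting `z ∈ C` makes a graph planar which contains the light side, then `z` separates
`a` from `b` on the heavy side of that graph. -/
lemma exists_closed_of_planar (h : HeavySide G a b C U) {H : SimpleGraph V}
    (hH : ∀ x, x ∉ C → ∀ y, y ∉ C → s(x, y) ≠ s(a, b) → G.Adj x y → H.Adj x y) {z : V}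
    (hz : z ∈ C) (hpl : ¬ NonplanarOn H {z}ᶜ) :
    ∃ X ⊆ U, a ∈ X ∧ b ∉ X ∧ z ∉ X ∧ ∀ x ∈ X, ∀ y ∈ U, y ≠ z → H.Adj x y → y ∈ X := by
  obtain ⟨X, hXS, haX, hXc, hcl⟩ := exists_component H (S := U \ {z, b}) (a := a)
    ⟨h.left_mem, by simpa using ⟨(h.ne_left hz).symm, h.ne⟩⟩
  have hzX : z ∉ X := fun hzX => (hXS hzX).2 (by simp)
  have hbX : b ∉ X := fun hbX => (hXS hbX).2 (by simp)
  refine ⟨X, fun x hx => (hXS hx).1, haX, hbX, hzX, fun x hx y hy hyz hxy => ?_⟩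
  refine hcl x hx y ⟨hy, ?_⟩ hxy
  rintro (rfl | rfl)
  · exact hyz rfl
  refine hpl (h.nonplanar_light.trans (MinorIn.of_expand a X hXc ?_ ?_ ?_ ?_ ?_))
  · intro x hx
    rintro rfl
    exact hzX hx
  · rintro s hs - rfl
    exact hs hz
  · intro s hs hsa hsX
    refine hs (h.mem_of_ne (hXS hsX).1 hsa ?_)
    rintro rfl
    exact hbX hsX
  · intro s hs hsa hadj
    by_cases hsb : s = y
    · exact ⟨x, hx, hsb ▸ hxy⟩
    · refine ⟨a, haX, hH a h.left_notMem s hs ?_ ?_⟩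
      · rw [Ne, Sym2.congr_right]
        exact hsb
      · obtain hadj | hadj := hadj
        · exact hadj
        · rw [edge_adj] at hadj
          tauto
  · intro s hs t ht hsa hta hadj
    have : s(s, t) ≠ s(a, y) := by
      rw [Ne, Sym2.eq_iff]
      tauto
    refine hH s hs t ht this ?_
    obtain hadj | hadj := hadj
    · exact hadj
    · rw [edge_adj] at hadj
      tauto

lemma eq_left_of_closed (h : HeavySide G a b C U) {z : V} {X : Set V} (hz : z ∈ C) (hXU : X ⊆ U)
    (hbX : b ∉ X) (hzX : z ∉ X)
    (hcl : ∀ x ∈ X, ∀ y ∈ U, y ≠ z → G.Adj x y → y ∈ X) : ∀ x ∈ X, x = a := by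
  have hE := h.eq_empty_of_cut (p := z) (q := a) (y := b) (X := X \ {a}) hz (h.ne_left hz) ?_
    (fun h => hzX h.1) (fun h => h.2 rfl) ?_ (fun h => hbX h.1) (h.ne_right hz).symm h.ne.symm
  · intro x hx
    by_contra hxa
    exact (hE ▸ (⟨hx, hxa⟩ : x ∈ X \ {a}) : x ∈ (∅ : Set V))
  · rintro x ⟨hx, hxa⟩
    exact h.mem_of_ne (hXU hx) hxa fun e => hbX (e ▸ hx)
  · rintro s ⟨hs, -⟩ t ht hst
    by_cases htz : t = z
    · exact Or.inr (Or.inl htz)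
    by_cases hta : t = a
    · exact Or.inr (Or.inr hta)
    exact Or.inl ⟨hcl s hs t ht htz hst, hta⟩

lemma exists_adj_ne (h : HeavySide G a b C U) {H : SimpleGraph V} {S : Set V} {w : V}
    (hS : ∀ s ∈ S, s ≠ a → s ∈ C) (hC : ¬ NonplanarOn H C) (hN : NonplanarOn H S) (hw : w ∈ C) :
    ∃ t ∈ S, t ≠ w ∧ H.Adj a t :=
  hN.exists_adj_ne (fun hN' => hC (hN'.mono (fun s hs => hS s hs.1 hs.2) fun _ _ _ _ h => h))
    (h.ne_left hw)

lemma nonplanarOn_side (h : HeavySide G a b C U) {H : SimpleGraph V} {X : Set V} {z : V}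
    (haX : a ∈ X) (hzX : z ∉ X)
    (hcl : ∀ x ∈ X, ∀ y ∈ U, y ≠ z → H.Adj x y → y ∈ X) (hC : ¬ NonplanarOn H C)
    (hN : NonplanarOn H (U \ {b})) : NonplanarOn H (X ∪ {z}) := by
  have hAB : (X ∪ {z}) ∩ Xᶜ = {z} := by
    ext x
    simp only [Set.mem_inter_iff, Set.mem_union, Set.mem_singleton_iff, Set.mem_compl_iff]
    constructor
    · tauto
    · rintro rfl
      exact ⟨Or.inr rfl, hzX⟩
  have hS : U \ {b} ⊆ (X ∪ {z}) ∪ Xᶜ := fun x _ => by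
    by_cases hx : x ∈ X
    · exact Or.inl (Or.inl hx)
    · exact Or.inr hx
  obtain h' | h' := hN.of_cutVertex hS hAB fun x hx hxA hxB y hy hyB hyA hxy => by
    refine hyB (hcl x (not_not.1 hxB) y hy.1 (fun e => hyA (Or.inr e)) hxy)
  · exact h'.mono Set.inter_subset_right fun _ _ _ _ h => h
  · refine absurd (h'.mono ?_ fun _ _ _ _ h => h) hC
    rintro x ⟨⟨hxU, hxb⟩, hxX⟩
    exact h.mem_of_ne hxU (fun e => hxX (e ▸ haX)) hxb

end HeavySide

/-- A vertex set closed under adjacency after contracting `uv` pulls back to a closed set. -/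
lemma closed_of_closed_contractEdge {V : Type} {G : SimpleGraph V} {X U : Set V} {u v z : V}
    (huv : G.Adj u v) (hXU : X ⊆ U) (hu : u ∈ U) (hv : v ∈ U) (hzu : z ≠ u)
    (hcl : ∀ x ∈ X, ∀ y ∈ U, y ≠ z → (contractEdge G u v).Adj x y → y ∈ X) :
    ∃ Y ⊆ U, (∀ x, x ≠ v → (x ∈ Y ↔ x ∈ X)) ∧
      ∀ x ∈ Y, ∀ y ∈ U, y ≠ z → G.Adj x y → y ∈ Y := by
  refine ⟨{x | (x ≠ v ∧ x ∈ X) ∨ (x = v ∧ u ∈ X)}, ?_, ?_, ?_⟩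
  · rintro x (⟨-, hx⟩ | ⟨rfl, -⟩)
    · exact hXU hx
    · exact hv
  · intro x hx
    simp [hx]
  · rintro x (⟨hxv, hx⟩ | ⟨rfl, hx⟩) y hy hyz hxy
    · by_cases hyv : y = v
      · refine Or.inr ⟨hyv, ?_⟩
        by_cases hxu : x = u
        · exact hxu ▸ hx
        · exact hcl x hx u hu hzu.symm
            (contractEdge_adj.2 ⟨hxu, hxv, huv.ne, Or.inr (Or.inr ⟨rfl, hyv ▸ hxy⟩)⟩)
      · exact Or.inl ⟨hyv, hcl x hx y hy hyz (contractEdge_adj_of_adj hxy hxv hyv)⟩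
    · refine Or.inl ⟨hxy.ne.symm, ?_⟩
      by_cases hyu : y = u
      · exact hyu ▸ hx
      · exact hcl u hx y hy hyz (contractEdge_adj.2
          ⟨Ne.symm hyu, huv.ne, hxy.ne.symm, Or.inr (Or.inl ⟨rfl, hxy⟩)⟩)

namespace HeavySide

variable {V : Type} {G : SimpleGraph V} {a b : V} {C U : Set V}

/-- The heavy side cannot consist of two nonplanar parts, one at `a` and one at `b`, which share
only `z` and are joined only by the edge `xy`. -/
lemma false_of_bridge (h : HeavySide G a b C U) {X : Set V} {x y z : V} (haX : a ∈ X)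
    (hXU : X ⊆ U) (hbX : b ∉ X) (hz : z ∈ C) (hzX : z ∉ X) (hxX : x ∈ X) (hxa : x ≠ a)
    (hyU : y ∈ U) (hyX : y ∉ X) (hyz : y ≠ z) (hyb : y ≠ b) (hxy : G.Adj x y)
    (hcross : ∀ s ∈ X, ∀ t ∈ U, t ∉ X → t ≠ z → G.Adj s t → s = x ∧ t = y)
    (hA : NonplanarOn (contractEdge G x y) (X ∪ {z}))
    (hB : NonplanarOn (contractEdge G y x) (U \ X)) : False := by
  have hxb : x ≠ b := fun e => hbX (e ▸ hxX)
  have hya : y ≠ a := fun e => hyX (e ▸ haX)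
  have hxC : x ∈ C := h.mem_of_ne (hXU hxX) hxa hxb
  have hyC : y ∈ C := h.mem_of_ne hyU hya hyb
  have hxz : x ≠ z := fun e => hzX (e ▸ hxX)
  have hC : ¬ NonplanarOn (contractEdge G x y) C := fun hN =>
    h.planar (hN.of_contractEdge hxy subset_rfl hxC hyC)
  have hC' : ¬ NonplanarOn (contractEdge G y x) C := fun hN =>
    h.planar (hN.of_contractEdge hxy.symm subset_rfl hyC hxC)
  have nbrA : ∀ w ∈ C, ∃ t ∈ X ∪ {z}, t ≠ w ∧ G.Adj a t := by
    intro w hw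
    have hS : ∀ s ∈ X ∪ {z}, s ≠ a → s ∈ C := by
      rintro s (hs | rfl) hsa
      · exact h.mem_of_ne (hXU hs) hsa fun e => hbX (e ▸ hs)
      · exact hz
    obtain ⟨t, ht, htw, hat⟩ := h.exists_adj_ne hS hC hA hw
    refine ⟨t, ht, htw, ?_⟩
    obtain ⟨-, -, -, h' | h' | h'⟩ := contractEdge_adj.1 hat
    · exact h'
    · exact absurd h'.1.symm hxa
    · exact absurd (hcross a haX y hyU hyX hyz h'.2).1.symm hxa
  have nbrB : ∀ w ∈ C, ∃ t ∈ U \ X, t ≠ w ∧ G.Adj b t := by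
    intro w hw
    have hS : ∀ s ∈ U \ X, s ≠ b → s ∈ C := fun s hs hsb =>
      h.mem_of_ne hs.1 (fun e => hs.2 (e ▸ haX)) hsb
    obtain ⟨t, ht, htw, hbt⟩ := h.symm.exists_adj_ne hS hC' hB hw
    refine ⟨t, ht, htw, ?_⟩
    obtain ⟨-, -, -, h' | h' | h'⟩ := contractEdge_adj.1 hbt
    · exact h'
    · exact absurd h'.1.symm hyb
    · exact absurd (hcross x hxX b h.right_mem hbX (h.ne_right hz).symm h'.2.symm).2.symm hyb
  obtain ⟨w, hwy, hw⟩ := h.exists_apex_contractEdge x y hxy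
  have hwA : w = z ∨ w ∈ X := by
    by_contra! hcon
    refine hw (hA.mono ?_ fun _ _ _ _ h => h)
    rintro s (hs | rfl) rfl
    · exact hcon.2 hs
    · exact hcon.1 rfl
  have hwB : w = x ∨ w ∉ X := by
    by_contra! hcon
    refine hw (hB.contractEdge_swap hxy.ne.symm ?_ hcon.1.symm)
    rintro s hs - - rfl
    exact hs.2 hcon.2
  have hwC : w ∈ C := by
    obtain rfl | hwX := hwA
    · exact hz
    · obtain rfl | hwX' := hwB
      · exact hxC
      · exact absurd hwX hwX'
  obtain ⟨X', hX'U, haX', hbX', hwX', hcl⟩ := h.exists_closed_of_planar (fun s hs t ht _ hst =>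
    contractEdge_adj_of_adj hst (fun e => hs (e ▸ hyC)) (fun e => ht (e ▸ hyC))) hwC hw
  by_cases hwz : w = z
  · subst hwz
    obtain ⟨Y, hYU, hYX, hYcl⟩ := closed_of_closed_contractEdge hxy hX'U (hXU hxX) hyU hxz.symm hcl
    have hYa := h.eq_left_of_closed hz hYU (fun hb => hbX' ((hYX b hyb.symm).1 hb))
      (fun hb => hwX' ((hYX w hwy).1 hb)) hYcl
    obtain ⟨t, ht, htw, hat⟩ := nbrA w hz
    have htX := ht.resolve_right htw
    exact hat.ne.symm (hYa t (hYcl a ((hYX a hya.symm).2 haX') t (hXU htX) htw hat))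
  have hwx : w = x := by tauto
  subst hwx
  have hclG : ∀ s ∈ X', s ≠ y → ∀ t ∈ U, t ≠ w → t ≠ y → G.Adj s t → t ∈ X' :=
    fun s hs hsy t ht htw hty hst => hcl s hs t ht htw (contractEdge_adj_of_adj hst hsy hty)
  by_cases hzX' : z ∈ X'
  · have hE := h.eq_empty_of_cut (p := y) (q := b) (y := a) (X := {s ∈ U | s ∉ X ∧ s ∉ X' ∧ s ≠ y ∧
      s ≠ b}) hyC hyb ?_ (by simp) (by simp) ?_ (fun h => h.2.1 haX) hya.symm h.ne
    · obtain ⟨t, ⟨htU, htX⟩, hty, hbt⟩ := nbrB y hyC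
      refine (hE ▸ (⟨htU, htX, fun htX' => ?_, hty, hbt.ne.symm⟩ :
        t ∈ {s ∈ U | s ∉ X ∧ s ∉ X' ∧ s ≠ y ∧ s ≠ b}) : t ∈ (∅ : Set V))
      exact hbX' (hclG t htX' hty b h.right_mem hxb.symm hyb.symm hbt.symm)
    · rintro s ⟨hsU, hsX, -, -, hsb⟩
      exact h.mem_of_ne hsU (fun e => hsX (e ▸ haX)) hsb
    · rintro s ⟨hsU, hsX, hsX', hsy, hsb⟩ t ht hst
      by_cases hty : t = y
      · exact Or.inr (Or.inl hty)
      by_cases htb : t = b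
      · exact Or.inr (Or.inr htb)
      refine Or.inl ⟨ht, fun htX => ?_, fun htX' => ?_, hty, htb⟩
      · exact hsy (hcross t htX s hsU hsX (fun e => hsX' (e ▸ hzX')) hst.symm).2
      · exact hsX' (hclG t htX' hty s hsU (fun e => hsX (e ▸ hxX)) hsy hst.symm)
  · have hE := h.eq_empty_of_cut (p := w) (q := a) (y := b) (X := {s ∈ X | s ∈ X' ∧ s ≠ a}) hxC hxa
      ?_ (fun h => hwX' h.2.1) (by simp) ?_ (fun h => hbX h.1) hxb.symm h.ne.symm
    · obtain ⟨t, ht, htw, hat⟩ := nbrA w hxC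
      have hty : t ≠ y := by
        rintro rfl
        exact ht.elim hyX hyz
      have htU : t ∈ U := ht.elim (fun h => hXU h) fun e => e ▸ h.mem_of_mem hz
      have htX' := hclG a haX' hya.symm t htU htw hty hat
      have htX : t ∈ X := ht.resolve_right fun e => hzX' (e ▸ htX')
      exact (hE ▸ (⟨htX, htX', hat.ne.symm⟩ : t ∈ {s ∈ X | s ∈ X' ∧ s ≠ a}) : t ∈ (∅ : Set V))
    · rintro s ⟨hsX, -, hsa⟩
      exact h.mem_of_ne (hXU hsX) hsa fun e => hbX (e ▸ hsX)
    · rintro s ⟨hsX, hsX', hsa⟩ t ht hst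
      by_cases htw : t = w
      · exact Or.inr (Or.inl htw)
      by_cases hta : t = a
      · exact Or.inr (Or.inr hta)
      have hsw : s ≠ w := fun e => hwX' (e ▸ hsX')
      by_cases hty : t = y
      · exact absurd (hcross s hsX t ht (hty ▸ hyX) (hty ▸ hyz) hst).1 hsw
      have htX' := hclG s hsX' (fun e => hyX (e ▸ hsX)) t ht htw hty hst
      refine Or.inl ⟨?_, htX', hta⟩
      by_contra htX
      exact hsw (hcross s hsX t ht htX (fun e => hzX' (e ▸ htX')) hst).1

lemma false_of_unique_neighbor (h : HeavySide G a b C U) {A : Set V} {u v w : V} (haA : a ∈ A)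
    (hAU : A ⊆ U) (hbA : b ∉ A) (hu : u ∈ C) (hv : v ∈ C) (huA : u ∉ A) (hvA : v ∉ A)
    (huv : G.Adj u v) (hcl : ∀ s ∈ A, ∀ t ∈ U, G.Adj s t → t ∈ A ∨ t = u ∨ t = v)
    (hNA : NonplanarOn (contractEdge G u v) (A ∪ {u})) (hNB : NonplanarOn G (U \ A))
    (hnbr : ∀ s ∈ A, G.Adj u s → s = w) : False := by
  have hex : ∃ x ∈ A, x ≠ a ∧ G.Adj u x := by
    by_contra! hcon
    have hE := h.eq_empty_of_cut (p := v) (q := a) (y := b) (X := A \ {a}) hv (h.ne_left hv) ?_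
      (fun h => hvA h.1) (fun h => h.2 rfl) ?_ (fun h => hbA h.1) (h.ne_right hv).symm h.ne.symm
    · obtain ⟨t, ht, hta, htu, -⟩ := hNA.not_subset a u u
      exact (hE ▸ (⟨ht.resolve_right htu, hta⟩ : t ∈ A \ {a}) : t ∈ (∅ : Set V))
    · rintro s ⟨hs, hsa⟩
      exact h.mem_of_ne (hAU hs) hsa fun e => hbA (e ▸ hs)
    · rintro s ⟨hs, hsa⟩ t ht hst
      by_cases hta : t = a
      · exact Or.inr (Or.inr hta)
      obtain h' | rfl | h' := hcl s hs t ht hst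
      · exact Or.inl ⟨h', hta⟩
      · exact absurd hst.symm (hcon s hs hsa)
      · exact Or.inr (Or.inl h')
  obtain ⟨x, hxA, hxa, hux⟩ := hex
  refine h.false_of_bridge haA hAU hbA hv hvA hxA hxa (h.mem_of_mem hu) huA huv.ne (h.ne_right hu)
    hux.symm ?_ ?_ ?_
  · intro s hs t ht htA htv hst
    obtain h' | rfl | h' := hcl s hs t ht hst
    · exact absurd h' htA
    · exact ⟨(hnbr s hs hst.symm).trans (hnbr x hxA hux).symm, rfl⟩
    · exact absurd h' htv
  · refine hNA.contractEdge_diff.trans (MinorIn.of_expand u {v} (connSet_singleton _ _) (by simp)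
      (fun s hs hsu => Or.inl (hs.1.resolve_right hsu)) (fun s hs _ => hs.2) ?_ ?_)
    · intro s hs hsu hadj
      have hsA := hs.1.resolve_right hsu
      refine ⟨v, rfl, ?_⟩
      obtain ⟨-, -, -, h' | h' | h'⟩ := contractEdge_adj.1 hadj
      · have hsx := (hnbr s hsA h').trans (hnbr x hxA hux).symm
        exact contractEdge_adj.2 ⟨Ne.symm hs.2, huv.ne.symm, hsu, Or.inr (Or.inr ⟨hsx, huv.symm⟩)⟩
      · exact contractEdge_adj_of_adj h'.2 huv.ne.symm hsu
      · exact absurd h'.1 hsu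
    · intro s _ t _ hs ht hadj
      obtain ⟨-, -, -, h' | h' | h'⟩ := contractEdge_adj.1 hadj
      · exact contractEdge_adj_of_adj h' hs ht
      · exact absurd h'.1 hs
      · exact absurd h'.1 ht
  · exact hNB.mono subset_rfl fun s hs t ht hst => contractEdge_adj_of_adj hst
      (fun e => hs.2 (e ▸ hxA)) (fun e => ht.2 (e ▸ hxA))

/-- The situation where the ends of the edge `uv` separate the heavy side into a part `A` at `a`
and a part `B` at `b`, and `G - uv` has an apex vertex `z` outside `B ∪ {u, v}`. -/
lemma false_of_edge_cut_aux (h : HeavySide G a b C U) {A B : Set V} {u v z : V} (haA : a ∈ A)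
    (hbB : b ∈ B) (hU : ∀ x, x ∈ U ↔ x ∈ A ∨ x ∈ B ∨ x = u ∨ x = v)
    (hAB : ∀ x ∈ A, x ∉ B) (hu : u ∈ C) (hv : v ∈ C) (huA : u ∉ A) (hvA : v ∉ A) (huB : u ∉ B)
    (huv : G.Adj u v) (hno : ∀ x ∈ A, ∀ y ∈ B, ¬ G.Adj x y)
    (hNA : NonplanarOn (contractEdge G u v) (A ∪ {u}))
    (hNB : NonplanarOn (contractEdge G u v) (B ∪ {u}))
    (hzu : z ≠ u) (hzv : z ≠ v) (hzB : z ∉ B)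
    (hz : ¬ NonplanarOn (G.deleteEdges {s(u, v)}) {z}ᶜ) : False := by
  have hAU : A ⊆ U := fun x hx => (hU x).2 (Or.inl hx)
  have hbA : b ∉ A := fun hb => hAB b hb hbB
  have hAcl : ∀ s ∈ A, ∀ t ∈ U, G.Adj s t → t ∈ A ∨ t = u ∨ t = v := by
    intro s hs t ht hst
    obtain h' | h' | h' := (hU t).1 ht
    · exact Or.inl h'
    · exact absurd hst (hno s hs t h')
    · exact Or.inr h'
  have hNB' : NonplanarOn G (U \ A) := by
    refine hNB.of_contractEdge huv ?_ ⟨h.mem_of_mem hu, huA⟩ ⟨h.mem_of_mem hv, hvA⟩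
    rintro x (hx | rfl)
    · exact ⟨(hU x).2 (Or.inr (Or.inl hx)), fun hxA => hAB x hxA hx⟩
    · exact ⟨h.mem_of_mem hu, huA⟩
  have hNA' : NonplanarOn (contractEdge G v u) (A ∪ {v}) := by
    refine hNA.contractEdge_swap huv.ne ?_ (by simp)
    rintro s (hs | rfl) hsu hsv
    · exact Or.inl hs
    · exact absurd rfl hsu
  obtain ⟨X, hXS, huX, hXc, hcl⟩ := exists_component (G.deleteEdges {s(u, v)})
    (S := (A ∪ {u, v}) \ {z}) (a := u) ⟨by simp, hzu.symm⟩
  have hadj : ∀ s t, s ≠ v → t ≠ v → G.Adj s t → (G.deleteEdges {s(u, v)}).Adj s t := by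
    intro s t hs ht hst
    rw [deleteEdges_adj]
    refine ⟨hst, ?_⟩
    rw [Set.mem_singleton_iff, Sym2.eq_iff]
    tauto
  have hadj' : ∀ s t, s ≠ u → t ≠ u → G.Adj s t → (G.deleteEdges {s(u, v)}).Adj s t := by
    intro s t hs ht hst
    rw [deleteEdges_adj]
    refine ⟨hst, ?_⟩
    rw [Set.mem_singleton_iff, Sym2.eq_iff]
    tauto
  have hzX : z ∉ X := fun hz => (hXS hz).2 rfl
  have hvX : v ∉ X := by
    intro hvX
    refine hz (hNB.contractEdge_diff.trans (MinorIn.of_expand u X hXc ?_ ?_ ?_ ?_ ?_))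
    · rintro x hx rfl
      exact hzX hx
    · rintro s ⟨hs, -⟩ hsu rfl
      exact hzB (hs.resolve_right hsu)
    · rintro s ⟨hs, hsv⟩ hsu hsX
      have hsB := hs.resolve_right hsu
      obtain h' | h' | h' := (hXS hsX).1
      · exact hAB s h' hsB
      · exact hsu h'
      · exact hsv h'
    · rintro s ⟨hs, hsv⟩ hsu hst
      obtain ⟨-, -, -, h' | h' | h'⟩ := contractEdge_adj.1 hst
      · exact ⟨u, huX, hadj _ _ huv.ne hsv h'⟩
      · exact ⟨v, hvX, hadj' _ _ huv.ne.symm hsu h'.2⟩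
      · exact absurd h'.1 hsu
    · rintro s ⟨hs, hsv⟩ t ⟨ht, htv⟩ hsu htu hst
      obtain ⟨-, -, -, h' | h' | h'⟩ := contractEdge_adj.1 hst
      · exact hadj _ _ hsv htv h'
      · exact absurd h'.1 hsu
      · exact absurd h'.1 htu
  have hXA : ∀ x ∈ X, x ≠ u → x ∈ A := by
    intro x hx hxu
    obtain h' | h' | h' := (hXS hx).1
    · exact h'
    · exact absurd h' hxu
    · exact absurd (h' ▸ hx) hvX
  by_cases haX : a ∈ X
  · have hE := h.eq_empty_of_cut (p := v) (q := z) (y := u) (X := {s ∈ A | s ∉ X ∧ s ≠ z}) hv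
      hzv.symm ?_ (fun h => hvA h.1) (fun h => h.2.2 rfl) ?_ (fun h => huA h.1) huv.ne hzu.symm
    · refine h.false_of_unique_neighbor (w := z) haA hAU hbA hv hu hvA huA huv.symm
        (fun s hs t ht hst => (hAcl s hs t ht hst).imp_right Or.symm) hNA' hNB' ?_
      intro s hs hvs
      by_contra hsz
      have hsX : s ∉ X := by
        intro hsX
        refine hvX (hcl s hsX v ⟨by simp, hzv.symm⟩ (hadj' _ _ ?_ huv.ne.symm hvs.symm))
        exact fun e => huA (e ▸ hs)
      exact (hE ▸ (⟨hs, hsX, hsz⟩ : s ∈ {s ∈ A | s ∉ X ∧ s ≠ z}) : s ∈ (∅ : Set V))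
    · rintro s ⟨hs, hsX, -⟩
      exact h.mem_of_ne (hAU hs) (fun e => hsX (e ▸ haX)) fun e => hbA (e ▸ hs)
    · rintro s ⟨hs, hsX, hsz⟩ t ht hst
      by_cases htz : t = z
      · exact Or.inr (Or.inr htz)
      by_cases htv : t = v
      · exact Or.inr (Or.inl htv)
      have htX : t ∉ X := fun htX => hsX (hcl t htX s ⟨Or.inl hs, hsz⟩
        (hadj _ _ htv (fun e => hvA (e ▸ hs)) hst.symm))
      obtain h' | rfl | h' := hAcl s hs t ht hst
      · exact Or.inl ⟨h', htX, htz⟩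
      · exact absurd huX htX
      · exact absurd h' htv
  · have hE := h.eq_empty_of_cut (p := u) (q := z) (y := v) (X := X \ {u}) hu
      hzu.symm ?_ (fun h => h.2 rfl) (fun h => hzX h.1) ?_ (fun h => hvX h.1) huv.ne.symm hzv.symm
    · refine h.false_of_unique_neighbor (w := z) haA hAU hbA hu hv huA hvA huv hAcl hNA hNB' ?_
      intro s hs hus
      by_contra hsz
      have hsX := hcl u huX s ⟨Or.inl hs, hsz⟩ (hadj _ _ huv.ne (fun e => hvA (e ▸ hs)) hus)
      exact (hE ▸ (⟨hsX, hus.ne.symm⟩ : s ∈ X \ {u}) : s ∈ (∅ : Set V))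
    · rintro s ⟨hs, hsu⟩
      have hsA := hXA s hs hsu
      exact h.mem_of_ne (hAU hsA) (fun e => haX (e ▸ hs)) fun e => hbA (e ▸ hsA)
    · rintro s ⟨hs, hsu⟩ t ht hst
      have hsA := hXA s hs hsu
      by_cases htz : t = z
      · exact Or.inr (Or.inr htz)
      by_cases htu : t = u
      · exact Or.inr (Or.inl htu)
      refine Or.inl ⟨hcl s hs t ⟨hAcl s hsA t ht hst, htz⟩ (hadj' _ _ hsu htu hst), htu⟩

lemma false_of_edge_cut (h : HeavySide G a b C U) {A B : Set V} {u v : V} (haA : a ∈ A)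
    (hbB : b ∈ B) (hU : ∀ x, x ∈ U ↔ x ∈ A ∨ x ∈ B ∨ x = u ∨ x = v)
    (hAB : ∀ x ∈ A, x ∉ B) (hu : u ∈ C) (hv : v ∈ C) (huA : u ∉ A) (hvA : v ∉ A) (huB : u ∉ B)
    (hvB : v ∉ B) (huv : G.Adj u v) (hno : ∀ x ∈ A, ∀ y ∈ B, ¬ G.Adj x y)
    (hNA : NonplanarOn (contractEdge G u v) (A ∪ {u}))
    (hNB : NonplanarOn (contractEdge G u v) (B ∪ {u})) : False := by
  obtain ⟨z, hz⟩ := h.exists_apex_deleteEdges u v huv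
  by_cases hzuv : z = u ∨ z = v
  · have hzC : z ∈ C := by obtain rfl | rfl := hzuv <;> assumption
    have hadj : ∀ s t, s ≠ z → t ≠ z → G.Adj s t → (G.deleteEdges {s(u, v)}).Adj s t := by
      intro s t hs ht hst
      rw [deleteEdges_adj]
      refine ⟨hst, ?_⟩
      rw [Set.mem_singleton_iff, Sym2.eq_iff]
      obtain rfl | rfl := hzuv <;> tauto
    obtain ⟨X, hXU, haX, hbX, hzX, hcl⟩ := h.exists_closed_of_planar (fun s hs t ht _ hst =>
      hadj s t (fun e => hs (e ▸ hzC)) (fun e => ht (e ▸ hzC)) hst) hzC hz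
    have hclG : ∀ x ∈ X, ∀ y ∈ U, y ≠ z → G.Adj x y → y ∈ X := fun x hx y hy hyz hxy =>
      hcl x hx y hy hyz (hadj x y (fun e => hzX (e ▸ hx)) hyz hxy)
    have hXa := h.eq_left_of_closed hzC hXU hbX hzX hclG
    have hC : ¬ NonplanarOn (contractEdge G u v) C := fun hN =>
      h.planar (hN.of_contractEdge huv subset_rfl hu hv)
    have hAU : ∀ s ∈ A ∪ {u}, s ∈ U := by
      rintro s (hs | rfl)
      · exact (hU s).2 (Or.inl hs)
      · exact h.mem_of_mem hu
    have hS : ∀ s ∈ A ∪ {u}, s ≠ a → s ∈ C := by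
      intro s hs hsa
      refine h.mem_of_ne (hAU s hs) hsa ?_
      rintro rfl
      exact hs.elim (fun hs => hAB _ hs hbB) (h.ne_right hu).symm
    obtain ⟨t, ht, htu, hat⟩ := h.exists_adj_ne hS hC hNA hu
    obtain ⟨-, -, htv, h' | h' | h'⟩ := contractEdge_adj.1 hat
    · have htz : t ≠ z := by obtain rfl | rfl := hzuv <;> assumption
      exact h'.ne.symm (hXa t (hclG a haX t (hAU t ht) htz h'))
    · exact h.ne_left hu h'.1.symm
    · exact htu h'.1
  push Not at hzuv
  by_cases hzB : z ∈ B
  · refine h.symm.false_of_edge_cut_aux hbB haA ?_ (fun x hx hx' => hAB x hx' hx) hu hv huB hvB huA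
      huv (fun x hx y hy hxy => hno y hy x hx hxy.symm) hNB hNA hzuv.1 hzuv.2
      (fun hzA => hAB z hzA hzB) hz
    intro x
    rw [hU]
    tauto
  · exact h.false_of_edge_cut_aux haA hbB hU hAB hu hv huA hvA huB huv hno hNA hNB hzuv.1
      hzuv.2 hzB hz

lemma symm_closed {H : SimpleGraph V} {X : Set V} {z : V}
    (hcl : ∀ x ∈ X, ∀ y ∈ U, y ≠ z → H.Adj x y → y ∈ X) :
    ∀ x ∈ U \ (X ∪ {z}), ∀ y ∈ U, y ≠ z → H.Adj x y → y ∈ U \ (X ∪ {z}) := by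
  rintro x ⟨hxU, hx⟩ y hy hyz hxy
  refine ⟨hy, fun hyX => hx (Or.inl ?_)⟩
  exact hcl y (hyX.resolve_right hyz) x hxU (fun e => hx (Or.inr e)) hxy.symm

lemma contract (h : HeavySide G a b C U) {u v : V} (hu : u ∈ U) (hv : v ∈ U) (hva : v ≠ a)
    (hvb : v ≠ b) (huv : G.Adj u v) (hNa : NonplanarOn (contractEdge G u v) (U \ {a}))
    (hNb : NonplanarOn (contractEdge G u v) (U \ {b})) : False := by
  have hvC : v ∈ C := h.mem_of_ne hv hva hvb
  have hC : ¬ NonplanarOn (contractEdge G u v) C := by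
    intro hN
    by_cases huC : u ∈ C
    · exact h.planar (hN.of_contractEdge huv subset_rfl huC hvC)
    · refine h.planar (hN.mono subset_rfl fun s hs t ht hst => ?_)
      obtain ⟨-, -, -, h' | h' | h'⟩ := contractEdge_adj.1 hst
      · exact h'
      · exact absurd (h'.1 ▸ hs) huC
      · exact absurd (h'.1 ▸ ht) huC
  obtain ⟨z, hzv, hz⟩ := h.exists_apex_contractEdge u v huv
  have hza : z ∈ U \ {a} := by
    by_contra hza
    refine hz (hNa.mono ?_ fun _ _ _ _ h => h)
    rintro s hs rfl
    exact hza hs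
  have hzb : z ∈ U \ {b} := by
    by_contra hzb
    refine hz (hNb.mono ?_ fun _ _ _ _ h => h)
    rintro s hs rfl
    exact hzb hs
  have hzC : z ∈ C := h.mem_of_ne hza.1 hza.2 hzb.2
  obtain ⟨X, hXU, haX, hbX, hzX, hcl⟩ := h.exists_closed_of_planar (fun s hs t ht _ hst =>
    contractEdge_adj_of_adj hst (fun e => hs (e ▸ hvC)) (fun e => ht (e ▸ hvC))) hzC hz
  have hNX := h.nonplanarOn_side haX hzX hcl hC hNb
  have hNX' := h.symm.nonplanarOn_side (X := U \ (X ∪ {z}))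
    ⟨h.right_mem, fun hb => hb.elim hbX (h.ne_right hzC).symm⟩ (fun hz => hz.2 (Or.inr rfl))
    (symm_closed hcl) hC hNa
  by_cases hzu : z = u
  · subst hzu
    refine h.false_of_edge_cut (u := z) (v := v) (A := X \ {v}) (B := U \ (X ∪ {z, v}))
      ⟨haX, hva.symm⟩ ⟨h.right_mem, ?_⟩ ?_ ?_ hzC hvC (fun h => hzX h.1) (fun h => h.2 rfl)
      (fun h => h.2 (by simp)) (fun h => h.2 (by simp)) huv ?_ ?_ ?_
    · have := h.ne_right hzC
      simp only [Set.mem_union, Set.mem_insert_iff, Set.mem_singleton_iff]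
      tauto
    · intro x
      have h1 : x ∈ X → x ∈ U := fun hx => hXU hx
      have h2 : x = z → x ∈ U := fun e => e ▸ hu
      have h3 : x = v → x ∈ U := fun e => e ▸ hv
      simp only [Set.mem_sdiff, Set.mem_union, Set.mem_insert_iff, Set.mem_singleton_iff]
      tauto
    · exact fun x hx hx' => hx'.2 (Or.inl hx.1)
    · rintro s ⟨hs, hsv⟩ t ⟨ht, htX⟩ hst
      simp only [Set.mem_union, Set.mem_insert_iff, Set.mem_singleton_iff, not_or] at htX
      exact htX.1 (hcl s hs t ht htX.2.1 (contractEdge_adj_of_adj hst hsv htX.2.2))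
    · refine hNX.contractEdge_diff.mono ?_ fun _ _ _ _ h => h
      rintro x ⟨hx | hx, hxv⟩
      · exact Or.inl ⟨hx, hxv⟩
      · exact Or.inr hx
    · refine hNX'.contractEdge_diff.mono ?_ fun _ _ _ _ h => h
      intro x
      simp only [Set.mem_sdiff, Set.mem_union, Set.mem_insert_iff, Set.mem_singleton_iff]
      tauto
  · obtain ⟨Y, hYU, hYX, hYcl⟩ := closed_of_closed_contractEdge huv hXU hu hv hzu hcl
    have hYa := h.eq_left_of_closed hzC hYU (fun hb => hbX ((hYX b hvb.symm).1 hb))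
      (fun hb => hzX ((hYX z hzv).1 hb)) hYcl
    obtain ⟨t, ht, hta, htv, htz⟩ := hNX.not_subset a v z
    exact hta (hYa t ((hYX t htv).2 (ht.resolve_right htz)))

lemma exists_crossing (h : HeavySide G a b C U) {X : Set V} {z : V} (hz : z ∈ C) (hXU : X ⊆ U)
    (hbX : b ∉ X) (hzX : z ∉ X) {H : SimpleGraph V} (hN : NonplanarOn H (X ∪ {z})) :
    ∃ x ∈ X, x ≠ a ∧ ∃ y ∈ U, y ∉ X ∧ y ≠ z ∧ G.Adj x y := by
  by_contra! hcon
  have hE := h.eq_empty_of_cut (p := z) (q := a) (y := b) (X := X \ {a}) hz (h.ne_left hz) ?_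
    (fun h => hzX h.1) (fun h => h.2 rfl) ?_ (fun h => hbX h.1) (h.ne_right hz).symm h.ne.symm
  · obtain ⟨t, ht, hta, htz, -⟩ := hN.not_subset a z z
    exact (hE ▸ (⟨ht.resolve_right htz, hta⟩ : t ∈ X \ {a}) : t ∈ (∅ : Set V))
  · rintro s ⟨hs, hsa⟩
    exact h.mem_of_ne (hXU hs) hsa fun e => hbX (e ▸ hs)
  · rintro s ⟨hs, hsa⟩ t ht hst
    by_cases hta : t = a
    · exact Or.inr (Or.inr hta)
    by_cases htz : t = z
    · exact Or.inr (Or.inl htz)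
    refine Or.inl ⟨?_, hta⟩
    by_contra htX
    exact hcon s hs hsa t ht htX htz hst

lemma delete (h : HeavySide G a b C U) {u v : V} (hu : u ∈ U) (hv : v ∈ U)
    (hNa : NonplanarOn (G.deleteEdges {s(u, v)}) (U \ {a}))
    (hNb : NonplanarOn (G.deleteEdges {s(u, v)}) (U \ {b})) (huv : G.Adj u v) : False := by
  have hDG : ∀ s t, (G.deleteEdges {s(u, v)}).Adj s t → G.Adj s t := fun s t hst =>
    (deleteEdges_adj.1 hst).1
  have hGD : ∀ s t, G.Adj s t → s(s, t) ≠ s(u, v) → (G.deleteEdges {s(u, v)}).Adj s t :=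
    fun s t hst hne => deleteEdges_adj.2 ⟨hst, hne⟩
  have hC : ¬ NonplanarOn (G.deleteEdges {s(u, v)}) C := fun hN =>
    h.planar (hN.mono subset_rfl fun s _ t _ => hDG s t)
  obtain ⟨z, hz⟩ := h.exists_apex_deleteEdges u v huv
  have hza : z ∈ U \ {a} := by
    by_contra hza
    refine hz (hNa.mono ?_ fun _ _ _ _ h => h)
    rintro s hs rfl
    exact hza hs
  have hzb : z ∈ U \ {b} := by
    by_contra hzb
    refine hz (hNb.mono ?_ fun _ _ _ _ h => h)
    rintro s hs rfl
    exact hzb hs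
  have hzC : z ∈ C := h.mem_of_ne hza.1 hza.2 hzb.2
  have hout : ∀ s, s ∉ C → s ∈ U → s = a ∨ s = b := fun s hs hsU => by
    have := (h.mem_iff s).1 hsU
    tauto
  obtain ⟨X, hXU, haX, hbX, hzX, hcl⟩ := h.exists_closed_of_planar (fun s hs t ht hne hst =>
    hGD s t hst (fun e => by
      have hsU : s ∈ U ∧ t ∈ U := by
        obtain ⟨rfl, rfl⟩ | ⟨rfl, rfl⟩ := Sym2.eq_iff.1 e
        exacts [⟨hu, hv⟩, ⟨hv, hu⟩]
      have h1 := hout s hs hsU.1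
      have h2 := hout t ht hsU.2
      have h3 := hst.ne
      rw [Ne, Sym2.eq_iff] at hne
      obtain rfl | rfl := h1 <;> obtain rfl | rfl := h2 <;> tauto)) hzC hz
  have hNX := h.nonplanarOn_side haX hzX hcl hC hNb
  have hNX' := h.symm.nonplanarOn_side (X := U \ (X ∪ {z}))
    ⟨h.right_mem, fun hb => hb.elim hbX (h.ne_right hzC).symm⟩ (fun hz => hz.2 (Or.inr rfl))
    (symm_closed hcl) hC hNa
  have hedge : ∀ s ∈ X, ∀ t ∈ U, t ∉ X → t ≠ z → G.Adj s t → s(s, t) = s(u, v) := by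
    intro s hs t ht htX htz hst
    by_contra hne
    exact htX (hcl s hs t ht htz (hGD s t hst hne))
  have huniq : ∀ s ∈ X, ∀ t, t ∉ X → ∀ s' ∈ X, ∀ t', t' ∉ X → s(s, t) = s(s', t') →
      s = s' ∧ t = t' := by
    intro s hs t ht s' hs' t' ht' e
    obtain h' | ⟨rfl, rfl⟩ := Sym2.eq_iff.1 e
    · exact h'
    · exact absurd hs ht'
  obtain ⟨x, hxX, hxa, y, hyU, hyX, hyz, hxy⟩ := h.exists_crossing hzC hXU hbX hzX hNX
  obtain ⟨y', hy', hyb', x', hxU', hxX', hxz', hxy'⟩ := h.symm.exists_crossing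
    (X := U \ (X ∪ {z})) hzC Set.sdiff_subset (fun ha => ha.2 (Or.inl haX))
    (fun hz => hz.2 (Or.inr rfl)) hNX'
  have hxX'' : x' ∈ X := by
    by_contra hcon
    exact hxX' ⟨hxU', fun h' => h'.elim hcon hxz'⟩
  have hyX' : y' ∉ X := fun h' => hy'.2 (Or.inl h')
  have hyz' : y' ≠ z := fun h' => hy'.2 (Or.inr h')
  have hxyuv := hedge x hxX y hyU hyX hyz hxy
  have hyb : y ≠ b := by
    rwa [(huniq x hxX y hyX x' hxX'' y' hyX' (hxyuv.trans
      (hedge x' hxX'' y' hy'.1 hyX' hyz' hxy'.symm).symm)).2]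
  refine h.false_of_bridge haX hXU hbX hzC hzX hxX hxa hyU hyX hyz hyb hxy ?_ ?_ ?_
  · intro s hs t ht htX htz hst
    exact huniq s hs t htX x hxX y hyX ((hedge s hs t ht htX htz hst).trans hxyuv.symm)
  · refine hNX.mono subset_rfl fun s hs t ht hst => contractEdge_adj_of_adj (hDG s t hst) ?_ ?_
    · rintro rfl
      exact hs.elim hyX hyz
    · rintro rfl
      exact ht.elim hyX hyz
  · refine hNX'.mono ?_ fun s hs t ht hst => contractEdge_adj_of_adj (hDG s t hst) ?_ ?_
    · rintro s (⟨hs, hs'⟩ | rfl)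
      · exact ⟨hs, fun h' => hs' (Or.inl h')⟩
      · exact ⟨hza.1, hzX⟩
    · rintro rfl
      exact hs.elim (fun h' => h'.2 (Or.inl hxX)) fun h' => hzX (h' ▸ hxX)
    · rintro rfl
      exact ht.elim (fun h' => h'.2 (Or.inl hxX)) fun h' => hzX (h' ▸ hxX)

end HeavySide

lemma minorIn_subdivideEdge {V : Type} (G : SimpleGraph V) (u v : V) :
    MinorIn G Set.univ (subdivideEdge G u v) Set.univ := by
  have hnone : ∀ w, w = u ∨ w = v → (subdivideEdge G u v).Adj none (some w) := by
    intro w hw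
    rw [subdivideEdge, fromRel_adj]
    exact ⟨by simp, Or.inl (Or.inr ⟨rfl, by simpa using hw⟩)⟩
  refine ⟨fun w => {x | x = some w ∨ (x = none ∧ w = u)}, fun _ _ => Set.subset_univ _, ?_, ?_, ?_⟩
  · intro w _
    by_cases hw : w = u
    · have : {x | x = some w ∨ (x = none ∧ w = u)} = {none, some w} := by
        ext x
        simp [hw, or_comm]
      simpa only [this] using connSet_pair (hnone w (Or.inl hw))
    · have : {x | x = some w ∨ (x = none ∧ w = u)} = {some w} := by
        ext x
        simp [hw]
      simpa only [this] using connSet_singleton _ _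
  · intro w _ w' _ hne
    rw [Set.disjoint_left]
    rintro x (rfl | ⟨rfl, rfl⟩) (h | ⟨h, rfl⟩)
    · exact hne (Option.some.inj h)
    · cases h
    · cases h
    · exact hne rfl
  · intro w _ w' _ hadj
    by_cases he : s(w, w') = s(u, v)
    · obtain ⟨rfl, rfl⟩ | ⟨rfl, rfl⟩ := Sym2.eq_iff.1 he
      · exact ⟨none, Or.inr ⟨rfl, rfl⟩, some w', Or.inl rfl, hnone w' (Or.inr rfl)⟩
      · exact ⟨some w, Or.inl rfl, none, Or.inr ⟨rfl, rfl⟩, (hnone w (Or.inr rfl)).symm⟩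
    · refine ⟨some w, Or.inl rfl, some w', Or.inl rfl, ?_⟩
      rw [subdivideEdge, fromRel_adj]
      exact ⟨by simpa using hadj.ne, Or.inl (Or.inl ⟨w, w', rfl, rfl, hadj, he⟩)⟩

lemma MinorIn.of_iso {V W : Type} {G : SimpleGraph V} {H : SimpleGraph W} (e : G ≃g H) :
    MinorIn G Set.univ H Set.univ :=
  MinorIn.of_map e (fun _ _ => trivial) (fun _ _ _ _ h => e.injective h)
    fun _ _ _ _ h => e.map_adj_iff.2 h

lemma IsSubdivision.minorIn {V W : Type} {G : SimpleGraph V} {H : SimpleGraph W}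
    (h : IsSubdivision G H) : MinorIn G Set.univ H Set.univ := by
  induction h with
  | of_iso e => exact MinorIn.of_iso e
  | step _ _ e ih => exact (ih.trans (minorIn_subdivideEdge _ _ _)).trans (MinorIn.of_iso e)

lemma IsKuratowski.nonplanarOn {V : Type} {G : SimpleGraph V} {H : G.Subgraph}
    (h : IsKuratowski H) : NonplanarOn G H.verts := by
  have hm : MinorIn H.coe Set.univ G H.verts :=
    MinorIn.of_map Subtype.val (fun w _ => w.2) (fun _ _ _ _ h => Subtype.ext h)
      fun _ _ _ _ h => H.adj_sub h
  exact h.imp (fun h => h.minorIn.trans hm) fun h => h.minorIn.trans hm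

lemma connected_induce_of_lt_vConn {V : Type} [Fintype V] {G : SimpleGraph V} (s : Finset V)
    (hs : s.card < vConn G) : (G.induce ((↑s : Set V)ᶜ)).Connected := by
  have hbdd : BddAbove
      {k : ℕ | ∀ s : Finset V, s.card < k → (G.induce ((↑s : Set V)ᶜ)).Connected} := by
    by_contra hcon
    rw [vConn, Nat.sSup_of_not_bddAbove hcon] at hs
    exact Nat.not_lt_zero _ hs
  have hmem := Nat.sSup_mem ⟨0, fun s hs => absurd hs (Nat.not_lt_zero _)⟩ hbdd
  exact hmem s hs

lemma not_preconnected_of_closed {V : Type} {G : SimpleGraph V} {S X : Set V} {y : V} (hXS : X ⊆ S)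
    (hX : X.Nonempty) (hcl : ∀ x ∈ X, ∀ y ∈ S, G.Adj x y → y ∈ X) (hy : y ∈ S) (hyX : y ∉ X) :
    ¬ (G.induce S).Preconnected := by
  intro hp
  have : Nonempty S := ⟨⟨y, hy⟩⟩
  exact hyX (((connSet_iff G S).2 ⟨hp⟩).2 X hXS hX hcl hy)

lemma ConnSet.insert {V : Type} {G : SimpleGraph V} {L : Set V} {a x : V} (hL : ConnSet G L)
    (hx : x ∈ L) (hax : G.Adj a x) : ConnSet G (insert a L) := by
  refine ⟨⟨a, by simp⟩, fun T hT hne hcl => ?_⟩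
  have hxT : x ∈ T := by
    obtain ⟨t, ht⟩ := hne
    obtain rfl | htL := hT ht
    · exact hcl t ht x (Or.inr hx) hax
    · exact (hL.2 (T ∩ L) Set.inter_subset_right ⟨t, ht, htL⟩ (fun s hs r hr hsr =>
        ⟨hcl s hs.1 r (Or.inr hr) hsr, hr⟩) hx).1
  rintro y (rfl | hy)
  · exact hcl x hxT y (Or.inl rfl) hax.symm
  · exact (hL.2 (T ∩ L) Set.inter_subset_right ⟨x, hxT, hx⟩ (fun s hs r hr hsr =>
        ⟨hcl s hs.1 r (Or.inr hr) hsr, hr⟩) hy).1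

lemma IsCompOf.connSet {V : Type} {G : SimpleGraph V} {S C : Set V} (h : IsCompOf G S C) :
    ConnSet G C := (connSet_iff G C).2 h.2.2.1

lemma IsCompOf.subset {V : Type} {G : SimpleGraph V} {S C D : Set V} {x : V} (hC : IsCompOf G S C)
    (hD : IsCompOf G S D) (hxC : x ∈ C) (hxD : x ∈ D) : C ⊆ D := fun _ hy =>
  (hC.connSet.2 (C ∩ D) Set.inter_subset_left ⟨x, hxC, hxD⟩ (fun s hs t ht hst =>
    ⟨ht, hD.2.2.2 s hs.2 t (Set.disjoint_left.1 hC.2.1 ht) hst⟩) hy).2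

lemma IsCompOf.notMem {V : Type} {G : SimpleGraph V} {S C D : Set V} {x : V} (hC : IsCompOf G S C)
    (hD : IsCompOf G S D) (hne : C ≠ D) (hxC : x ∈ C) : x ∉ D := fun hxD =>
  hne ((hC.subset hD hxC hxD).antisymm (hD.subset hC hxD hxC))

lemma IsCompOf.exists_adj {V : Type} [Fintype V] {G : SimpleGraph V} {a b : V} {L : Set V}
    (hL : IsCompOf G {a, b} L) (hab : a ≠ b) (hk : vConn G = 2) : ∃ x ∈ L, G.Adj a x := by
  by_contra! hcon
  have hLS : ∀ x ∈ L, x ≠ a ∧ x ≠ b := fun x hx => by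
    simpa using Set.disjoint_left.1 hL.2.1 hx
  refine not_preconnected_of_closed (G := G) (S := ((↑({b} : Finset V) : Set V)ᶜ)) (X := L) (y := a)
    ?_ hL.1 ?_ ?_ ?_ (connected_induce_of_lt_vConn {b} (by simp [hk])).preconnected
  · intro x hx
    simpa using (hLS x hx).2
  · intro x hx y hy hxy
    refine hL.2.2.2 x hx y ?_ hxy
    rintro (rfl | rfl)
    · exact hcon x hx hxy.symm
    · simp at hy
  · simpa using hab
  · exact fun ha => (hLS a ha).1 rfl

lemma IsApexObstruction.exists_apex {V : Type} {G H : SimpleGraph V} (hG : IsApexObstruction G)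
    {S : Set V} (hS : S.Nonempty) (hm : MinorIn H S G Set.univ)
    (hiso : IsEmpty (H.induce S ≃g G)) : ∃ z ∈ S, ¬ NonplanarOn H (S \ {z}) := by
  classical
  obtain h | ⟨z, hz⟩ := hG.2 S (H.induce S)
    ((isMinorOf_iff _ _).2 ((minorIn_induce H S).trans hm)) hiso
  · obtain ⟨z, hz⟩ := hS
    refine ⟨z, hz, fun hN => ?_⟩
    exact (not_isPlanar_induce_iff H S).2 (hN.mono Set.sdiff_subset fun _ _ _ _ h => h) h
  · refine ⟨z, z.2, fun hN => (not_isPlanar_induce_iff _ _).2 ?_ hz⟩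
    refine hN.trans (MinorIn.of_map (fun x => if hx : x ∈ S then ⟨x, hx⟩ else z) ?_ ?_ ?_)
    · rintro w ⟨hw, hwz⟩
      simpa [hw, Subtype.ext_iff] using hwz
    · rintro w ⟨hw, -⟩ w' ⟨hw', -⟩ h
      simpa [hw, hw'] using h
    · rintro w ⟨hw, -⟩ w' ⟨hw', -⟩ h
      simpa [hw, hw'] using h

lemma isEmpty_iso_of_notMem {V : Type} [Finite V] {G H : SimpleGraph V} {S : Set V} {x : V}
    (hx : x ∉ S) : IsEmpty (H.induce S ≃g G) := by
  refine ⟨fun e => ?_⟩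
  have hinj : Function.Injective fun y => ((e.symm y : S) : V) :=
    Subtype.val_injective.comp e.symm.injective
  obtain ⟨y, hy⟩ := Finite.surjective_of_injective hinj x
  exact hx (hy ▸ (e.symm y).2)

lemma isEmpty_iso_of_lt {V : Type} [Fintype V] {G H : SimpleGraph V} (h : H < G) :
    IsEmpty (H.induce Set.univ ≃g G) := by
  classical
  refine ⟨fun e => ?_⟩
  have h1 := Iso.card_edgeFinset_eq ((induceUnivIso H).symm.trans e)
  exact (Finset.card_lt_card (edgeFinset_ssubset_edgeFinset.2 h)).ne h1

theorem IsApexObstruction.heavySide {V : Type} [Fintype V] {G : SimpleGraph V} {a b : V}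
    {C L : Set V} (hobs : IsApexObstruction G) (hk : vConn G = 2)
    (huniq : ∀ T : Set V, IsTwoCut G T → T = ({a, b} : Set V)) (hab : a ≠ b)
    (hheavy : IsHeavyComp G a b C) (hlight : IsCompOf G {a, b} L) (hLC : L ≠ C)
    (hplanarC : IsPlanar (G.induce C)) : HeavySide G a b C (C ∪ {a, b}) := by
  obtain ⟨hC, ⟨Ha, ⟨hHa, haHa⟩, hHaC⟩, ⟨Hb, ⟨hHb, hbHb⟩, hHbC⟩⟩ := hheavy
  have hCab : ∀ x ∈ C, x ≠ a ∧ x ≠ b := fun x hx => by simpa using Set.disjoint_left.1 hC.2.1 hx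
  have hnadj : ∀ x ∈ C, ∀ y, y ∉ C ∪ {a, b} → ¬ G.Adj x y := fun x hx y hy hxy =>
    hy (Or.inl (hC.2.2.2 x hx y (fun h => hy (Or.inr h)) hxy))
  refine ⟨?_, hab, fun h => (hCab a h).1 rfl, fun h => (hCab b h).2 rfl, hnadj, ?_, ?_, ?_, ?_,
    fun h => (not_isPlanar_induce_iff G C).2 h hplanarC⟩
  · intro x
    simp only [Set.mem_union, Set.mem_insert_iff, Set.mem_singleton_iff]
    tauto
  · intro p q X hp hpq hX hpX hqX hcl y hyp hyq
    by_contra hyX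
    have hcutpq : IsTwoCut G {p, q} := by
      refine ⟨Set.ncard_pair hpq, not_preconnected_of_closed (X := X) (y := y) ?_ hX ?_ ?_ hyX⟩
      · rintro x hx (rfl | rfl)
        · exact hpX hx
        · exact hqX hx
      · intro x hx t ht hxt
        have := hcl x hx t hxt
        simp only [Set.mem_compl_iff, Set.mem_insert_iff, Set.mem_singleton_iff] at ht
        tauto
      · simp [hyp, hyq]
    have hpab : p ∈ ({a, b} : Set V) := huniq _ hcutpq ▸ Set.mem_insert p {q}
    exact Set.disjoint_left.1 hC.2.1 hp hpab
  · intro u v huv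
    have hlt : G.deleteEdges {s(u, v)} < G := by
      refine lt_of_le_of_ne (deleteEdges_le _) fun e => ?_
      rw [← e, deleteEdges_adj] at huv
      exact huv.2 rfl
    obtain ⟨z, -, hz⟩ := hobs.exists_apex (H := G.deleteEdges {s(u, v)}) (S := Set.univ)
      ⟨a, trivial⟩ (MinorIn.of_map id (fun _ _ => trivial) (fun _ _ _ _ h => h)
        fun _ _ _ _ h => (deleteEdges_adj.1 h).1) (isEmpty_iso_of_lt hlt)
    exact ⟨z, fun hN => hz (hN.mono (fun x hx => ⟨trivial, hx⟩) fun _ _ _ _ h => h)⟩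
  · intro u v huv
    obtain ⟨z, hzv, hz⟩ := hobs.exists_apex (S := Set.univ \ {v}) ⟨u, trivial, huv.ne⟩
      (minorIn_of_contractEdge huv subset_rfl trivial trivial)
      (isEmpty_iso_of_notMem (x := v) fun h => h.2 rfl)
    exact ⟨z, hzv.2, fun hN => hz (hN.contractEdge_diff.mono (fun x hx => ⟨⟨trivial, hx.2⟩, hx.1⟩)
      fun _ _ _ _ h => h)⟩
  · obtain ⟨x, hx, hax⟩ := hlight.exists_adj hab hk
    obtain ⟨y, hy, hby⟩ := (Set.pair_comm a b ▸ hlight).exists_adj hab.symm hk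
    have hxU : x ∉ C ∪ {a, b} := fun h => h.elim (hlight.notMem hC hLC hx)
      (Set.disjoint_left.1 hlight.2.1 hx)
    have hm : MinorIn (G ⊔ edge a b) (C ∪ {a, b}) G Set.univ := by
      refine MinorIn.of_expand a (insert a L) (hlight.connSet.insert hx hax) (Set.subset_univ _)
        (fun _ _ _ => trivial) ?_ ?_ ?_
      · rintro s hs hsa (h | h)
        · exact hsa h
        · exact hs.elim (hlight.notMem hC hLC h) (Set.disjoint_left.1 hlight.2.1 h)
      · intro s hs hsa hadj
        rw [sup_adj, edge_adj] at hadj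
        by_cases hsb : s = b
        · exact ⟨y, Or.inr hy, hsb ▸ hby.symm⟩
        · exact ⟨a, Or.inl rfl, by tauto⟩
      · intro s _ t _ hsa hta hadj
        rw [sup_adj, edge_adj] at hadj
        tauto
    obtain ⟨z, -, hz⟩ := hobs.exists_apex (S := C ∪ {a, b}) ⟨a, by simp⟩ hm
      (isEmpty_iso_of_notMem hxU)
    have hza : z ≠ a := by
      rintro rfl
      refine hz (hHa.nonplanarOn.mono (fun s hs => ⟨hHaC hs, ?_⟩) fun _ _ _ _ h => Or.inl h)
      rintro rfl
      exact haHa hs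
    have hzb : z ≠ b := by
      rintro rfl
      refine hz (hHb.nonplanarOn.mono (fun s hs => ⟨hHbC hs, ?_⟩) fun _ _ _ _ h => Or.inl h)
      rintro rfl
      exact hbHb hs
    have hGz : NonplanarOn G {z}ᶜ :=
      (not_isPlanar_induce_iff G _).1 fun h => hobs.1 (Or.inr ⟨z, h⟩)
    have hcover : ({z}ᶜ : Set V) ⊆ (C ∪ {a, b}) ∪ Cᶜ := by
      intro s _
      by_cases hs : s ∈ C
      · exact Or.inl (Or.inl hs)
      · exact Or.inr hs
    have hinter : (C ∪ {a, b}) ∩ Cᶜ = {a, b} := by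
      ext s
      have := hCab s
      simp only [Set.mem_inter_iff, Set.mem_union, Set.mem_insert_iff, Set.mem_singleton_iff,
        Set.mem_compl_iff]
      tauto
    obtain h | h := hGz.of_separation hcover hinter fun s _ _ hsC t _ _ ht =>
      hnadj s (not_not.1 hsC) t ht
    · exact (hz (h.mono (fun s hs => ⟨hs.2, hs.1⟩) fun _ _ _ _ h => h)).elim
    · exact h.mono Set.inter_subset_right fun _ _ _ _ h => h

/-- The basic deletion/contraction lemma for `J = G[C ∪ {a,b}]` under the standard
assumptions. -/
theorem basic_deletion_contraction_lemma {V : Type} [Fintype V] (G : SimpleGraph V) (a b : V) (C L : Set V)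
    (hobs : IsApexObstruction G)
    (hk : vConn G = 2)
    (hcut : IsTwoCut G {a, b})
    (huniq : ∀ T : Set V, IsTwoCut G T → T = ({a, b} : Set V))
    (hab : a ≠ b)
    (hheavy : IsHeavyComp G a b C)
    (hlight : IsCompOf G {a, b} L) (hLC : L ≠ C)
    (hplanarC : IsPlanar (G.induce C)) :
    (∀ u v : V, (restrictTo G (C ∪ {a, b})).Adj u v →
      IsPlanar (((restrictTo G (C ∪ {a, b})).deleteEdges {s(u, v)}).induce {x | x ≠ a}) ∨
      IsPlanar (((restrictTo G (C ∪ {a, b})).deleteEdges {s(u, v)}).induce {x | x ≠ b})) ∧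
    (∀ u v : V, (restrictTo G (C ∪ {a, b})).Adj u v → v ≠ a → v ≠ b →
      IsPlanar ((contractEdge (restrictTo G (C ∪ {a, b})) u v).induce {x | x ≠ a}) ∨
      IsPlanar ((contractEdge (restrictTo G (C ∪ {a, b})) u v).induce {x | x ≠ b})) := by
  have h : HeavySide G a b C (C ∪ {a, b}) :=
    hobs.heavySide hk huniq hab hheavy hlight hLC hplanarC
  have hJ : ∀ x y, (restrictTo G (C ∪ {a, b})).Adj x y →
      G.Adj x y ∧ x ∈ C ∪ {a, b} ∧ y ∈ C ∪ {a, b} := by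
    intro x y hxy
    simp only [restrictTo, fromRel_adj] at hxy
    obtain ⟨-, h | h⟩ := hxy
    · exact h
    · exact ⟨h.1.symm, h.2.2, h.2.1⟩
  refine ⟨fun u v huv => ?_, fun u v huv hva hvb => ?_⟩ <;>
    obtain ⟨huvG, hu, hv⟩ := hJ u v huv
  · have key : ∀ w, ¬ IsPlanar
        (((restrictTo G (C ∪ {a, b})).deleteEdges {s(u, v)}).induce {x | x ≠ w}) →
        NonplanarOn (G.deleteEdges {s(u, v)}) ((C ∪ {a, b}) \ {w}) := by
      intro w hw
      refine (((not_isPlanar_induce_iff _ _).1 hw).inter (U := C ∪ {a, b}) ?_).mono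
        (fun x hx => ⟨hx.2, hx.1⟩) ?_
      · exact fun x _ y _ hxy => (hJ x y (deleteEdges_adj.1 hxy).1).2.1
      · intro x _ y _ hxy
        rw [deleteEdges_adj] at hxy ⊢
        exact ⟨(hJ x y hxy.1).1, hxy.2⟩
    by_contra! hcon
    exact h.delete hu hv (key a hcon.1) (key b hcon.2) huvG
  · have hcJ : ∀ x y, (contractEdge (restrictTo G (C ∪ {a, b})) u v).Adj x y →
        (contractEdge G u v).Adj x y ∧ x ∈ C ∪ {a, b} := by
      intro x y hxy
      rw [contractEdge_adj] at hxy ⊢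
      obtain ⟨h1, h2, h3, h4 | ⟨rfl, h4⟩ | ⟨rfl, h4⟩⟩ := hxy
      · exact ⟨⟨h1, h2, h3, Or.inl (hJ _ _ h4).1⟩, (hJ _ _ h4).2.1⟩
      · exact ⟨⟨h1, h2, h3, Or.inr (Or.inl ⟨rfl, (hJ _ _ h4).1⟩)⟩, hu⟩
      · exact ⟨⟨h1, h2, h3, Or.inr (Or.inr ⟨rfl, (hJ _ _ h4).1⟩)⟩, (hJ _ _ h4).2.1⟩
    have key : ∀ w, ¬ IsPlanar
        ((contractEdge (restrictTo G (C ∪ {a, b})) u v).induce {x | x ≠ w}) →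
        NonplanarOn (contractEdge G u v) ((C ∪ {a, b}) \ {w}) := by
      intro w hw
      refine (((not_isPlanar_induce_iff _ _).1 hw).inter (U := C ∪ {a, b}) ?_).mono
        (fun x hx => ⟨hx.2, hx.1⟩) ?_
      · exact fun x _ y _ hxy => (hcJ x y hxy).2
      · exact fun x _ y _ hxy => (hcJ x y hxy).1
    by_contra! hcon
    exact h.contract hu hv hva hvb huvG (key a hcon.1) (key b hcon.2)
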